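/- arXiv:0710.3071 — 10 statements merged into one kernel-verified Lean document; each statement's English description precedes it below -/
import Mathlib

section
/- Let φ : M_n(ℂ) → M_m(ℂ) be a linear map. Then the associated functional φ̃ defined by φ̃(a ⊗ b) = Tr(φ(a) bᵀ) is a separable positive linear functional on M_n(ℂ) ⊗ M_m(ℂ) if and only if φ is entanglement breaking, i.e. there exist finitely many positive semidefinite matrices a_i ∈ M_n(ℂ) and b_i ∈ M_m(ℂ) such that φ(x) = Σ_i Tr(a_i x) b_i for all x ∈ M_n(ℂ). -/
open Matrix
open scoped ComplexOrder Kronecker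

/-- A linear functional on a matrix algebra is positive if it is nonnegative on
positive semidefinite matrices. -/
def IsPosFun {d : Type*} [Fintype d] (σ : Matrix d d ℂ →ₗ[ℂ] ℂ) : Prop :=
  ∀ a : Matrix d d ℂ, a.PosSemidef → 0 ≤ σ a

/-- A linear functional on `M_n(ℂ) ⊗ M_m(ℂ)` (realized via the Kronecker product) is
separable if it is a finite sum of tensor products of positive linear functionals. -/
def IsSepFun (n m : ℕ) (ρ : Matrix (Fin n × Fin m) (Fin n × Fin m) ℂ →ₗ[ℂ] ℂ) : Prop :=
  ∃ (k : ℕ) (σ : Fin k → (Matrix (Fin n) (Fin n) ℂ →ₗ[ℂ] ℂ))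
    (ω : Fin k → (Matrix (Fin m) (Fin m) ℂ →ₗ[ℂ] ℂ)),
    (∀ i, IsPosFun (σ i)) ∧ (∀ i, IsPosFun (ω i)) ∧
    ∀ (a : Matrix (Fin n) (Fin n) ℂ) (b : Matrix (Fin m) (Fin m) ℂ),
      ρ (a ⊗ₖ b) = ∑ i, σ i a * ω i b

/-- A complex matrix with nonnegative quadratic form is positive semidefinite; hermitianness
is automatic. -/
theorem Matrix.posSemidef_of_forall_dotProduct_mulVec_nonneg {d : Type*} [Fintype d]
    {A : Matrix d d ℂ} (h : ∀ x : d → ℂ, 0 ≤ star x ⬝ᵥ (A *ᵥ x)) : A.PosSemidef := by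
  classical
  rw [← isPositive_toEuclideanLin_iff, LinearMap.isPositive_iff_complex]
  intro x
  have key : inner ℂ (A.toEuclideanLin x) x = star (star x.ofLp ⬝ᵥ (A *ᵥ x.ofLp)) := by
    rw [EuclideanSpace.inner_eq_star_dotProduct, ofLp_toLpLin, toLin'_apply, star_dotProduct,
      star_star, dotProduct_comm]
  have hx : 0 ≤ inner ℂ (A.toEuclideanLin x) x := by
    rw [key]
    exact star_nonneg_iff.mpr (h _)
  obtain ⟨hre, him⟩ := Complex.nonneg_iff.mp hx
  exact ⟨Complex.ext rfl him, hre⟩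

theorem Matrix.PosSemidef.trace_mul_nonneg {d : Type*} [Fintype d] {A B : Matrix d d ℂ}
    (hA : A.PosSemidef) (hB : B.PosSemidef) : 0 ≤ (A * B).trace := by
  obtain ⟨k, v, rfl⟩ := posSemidef_iff_eq_sum_vecMulVec.mp hB
  rw [Matrix.mul_sum, trace_sum]
  refine Finset.sum_nonneg fun i _ => ?_
  rw [mul_vecMulVec, trace_vecMulVec, dotProduct_comm]
  exact hA.dotProduct_mulVec_nonneg _

theorem exists_forall_eq_trace_mul {d : Type*} [Fintype d] (σ : Matrix d d ℂ →ₗ[ℂ] ℂ) :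
    ∃ A : Matrix d d ℂ, ∀ x, σ x = (A * x).trace := by
  classical
  refine ⟨of fun i j => σ (single j i 1), fun x => ?_⟩
  have h : σ = traceLinearMap d ℂ ℂ ∘ₗ
      LinearMap.mulLeft ℂ (of fun i j => σ (single j i 1)) := by
    refine Matrix.ext_linearMap ℂ fun i j => LinearMap.ext_ring ?_
    simp [trace_mul_single]
  exact LinearMap.congr_fun h x

theorem isPosFun_of_eq_trace_mul {d : Type*} [Fintype d] {σ : Matrix d d ℂ →ₗ[ℂ] ℂ}
    {A : Matrix d d ℂ} (hA : A.PosSemidef) (h : ∀ x, σ x = (A * x).trace) : IsPosFun σ :=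
  fun x hx => h x ▸ hA.trace_mul_nonneg hx

/-- Positive functionals on a matrix algebra have positive semidefinite densities. -/
theorem IsPosFun.exists_posSemidef {d : Type*} [Fintype d] {σ : Matrix d d ℂ →ₗ[ℂ] ℂ}
    (hσ : IsPosFun σ) :
    ∃ A : Matrix d d ℂ, A.PosSemidef ∧ ∀ x, σ x = (A * x).trace := by
  obtain ⟨A, hA⟩ := exists_forall_eq_trace_mul σ
  refine ⟨A, posSemidef_of_forall_dotProduct_mulVec_nonneg fun v => ?_, hA⟩
  have h := hσ _ (posSemidef_vecMulVec_self_star v)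
  rwa [hA, mul_vecMulVec, trace_vecMulVec, dotProduct_comm] at h

theorem Matrix.trace_mul_transpose_comm {d : Type*} [Fintype d] (A B : Matrix d d ℂ) :
    (A * Bᵀ).trace = (Aᵀ * B).trace := by
  rw [← trace_transpose, transpose_mul, transpose_transpose, trace_mul_comm]

/-- The functional `φ̃(a ⊗ b) = Tr(φ(a) bᵀ)` associated to a linear map
`φ : M_n(ℂ) → M_m(ℂ)` is a separable positive linear functional if and only if `φ` is
entanglement breaking, i.e. `φ(x) = Σ_i Tr(a_i x) b_i` with all `a_i`, `b_i`
positive semidefinite. -/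
theorem separable_iff_entanglement_breaking (n m : ℕ)
    (φ : Matrix (Fin n) (Fin n) ℂ →ₗ[ℂ] Matrix (Fin m) (Fin m) ℂ)
    (ρ : Matrix (Fin n × Fin m) (Fin n × Fin m) ℂ →ₗ[ℂ] ℂ)
    (hρ : ∀ (a : Matrix (Fin n) (Fin n) ℂ) (b : Matrix (Fin m) (Fin m) ℂ),
      ρ (a ⊗ₖ b) = (φ a * bᵀ).trace) :
    IsSepFun n m ρ ↔
      ∃ (k : ℕ) (a : Fin k → Matrix (Fin n) (Fin n) ℂ)
        (b : Fin k → Matrix (Fin m) (Fin m) ℂ),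
        (∀ i, (a i).PosSemidef) ∧ (∀ i, (b i).PosSemidef) ∧
        ∀ x : Matrix (Fin n) (Fin n) ℂ, φ x = ∑ i, (a i * x).trace • b i := by
  constructor
  · rintro ⟨k, σ, ω, hσ, hω, h⟩
    choose a ha haσ using fun i => (hσ i).exists_posSemidef
    choose b hb hbω using fun i => (hω i).exists_posSemidef
    refine ⟨k, a, fun i => (b i)ᵀ, ha, fun i => (hb i).transpose, fun x => ?_⟩
    refine ext_iff_trace_mul_right.mpr fun y => ?_
    have hxy := (hρ x yᵀ).symm.trans (h x yᵀ)
    rw [transpose_transpose] at hxy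
    simp [hxy, haσ, hbω, Matrix.sum_mul, trace_sum, trace_mul_transpose_comm]
  · rintro ⟨k, a, b, ha, hb, h⟩
    refine ⟨k, fun i => traceLinearMap _ ℂ ℂ ∘ₗ LinearMap.mulLeft ℂ (a i),
      fun i => traceLinearMap _ ℂ ℂ ∘ₗ LinearMap.mulLeft ℂ (b i)ᵀ,
      fun i => isPosFun_of_eq_trace_mul (ha i) fun _ => rfl,
      fun i => isPosFun_of_eq_trace_mul (hb i).transpose fun _ => rfl, fun x y => ?_⟩
    simp [hρ, h, Matrix.sum_mul, trace_sum, trace_mul_transpose_comm]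
end

section
/- Let φ : M_n(ℂ) → M_m(ℂ) be a linear map. Then the associated functional φ̃ defined by φ̃(a ⊗ b) = Tr(φ(a) bᵀ) is a separable positive linear functional if and only if φ̃(x) ≥ 0 for every Hermitian x ∈ M_n(ℂ) ⊗ M_m(ℂ) satisfying Tr(x (a ⊗ b)) ≥ 0 for all positive semidefinite a ∈ M_n(ℂ) and b ∈ M_m(ℂ). -/
open Matrix
open scoped ComplexOrder Kronecker

open Set in
/-- In a finite-dimensional space, the convex hull of a compact set is compact. -/
theorem IsCompact.convexHull_of_finiteDimensional {E : Type*} [AddCommGroup E] [Module ℝ E]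
    [TopologicalSpace E] [IsTopologicalAddGroup E] [ContinuousSMul ℝ E] [FiniteDimensional ℝ E]
    {s : Set E} (hs : IsCompact s) : IsCompact (convexHull ℝ s) := by
  have key : convexHull ℝ s = ⋃ k ∈ Finset.range (Module.finrank ℝ E + 2),
      (fun p : (Fin k → ℝ) × (Fin k → E) ↦ ∑ i, p.1 i • p.2 i) ''
        (stdSimplex ℝ (Fin k) ×ˢ univ.pi fun _ ↦ s) := by
    apply Subset.antisymm
    · intro x hx
      obtain ⟨ι, _, z, w, hz, hind, hw, hw1, rfl⟩ := eq_pos_convex_span_of_mem_convexHull hx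
      have hcard := hind.card_le_finrank_succ
      have hle := Submodule.finrank_le (vectorSpan ℝ (range z))
      let e := (Fintype.equivFin ι).symm
      refine mem_iUnion₂.2 ⟨Fintype.card ι, Finset.mem_range.2 (by omega),
        ⟨w ∘ e, z ∘ e⟩, ⟨⟨fun i ↦ (hw _).le, ?_⟩, fun i _ ↦ hz ⟨_, rfl⟩⟩, ?_⟩
      · simpa using (e.sum_comp w).trans hw1
      · exact e.sum_comp fun i ↦ w i • z i
    · refine iUnion₂_subset fun k _ ↦ ?_
      rintro _ ⟨⟨w, z⟩, ⟨hw, hz⟩, rfl⟩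
      exact mem_convexHull_of_exists_fintype w z hw.1 hw.2 (fun i ↦ hz i trivial) rfl
  rw [key]
  refine (Finset.range _).isCompact_biUnion fun k _ ↦ ?_
  exact ((isCompact_stdSimplex ℝ _).prod (isCompact_univ_pi fun _ ↦ hs)).image (by fun_prop)

namespace Matrix

/-- Every linear functional on a matrix algebra has the form `y ↦ Tr(z y)`. -/
theorem exists_forall_eq_trace_mul {R d : Type*} [CommSemiring R] [Fintype d] [DecidableEq d]
    (f : Matrix d d R →ₗ[R] R) : ∃ z : Matrix d d R, ∀ y, f y = (z * y).trace := by
  refine ⟨of fun i j ↦ f (single j i 1), fun y ↦ ?_⟩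
  conv_lhs => rw [matrix_eq_sum_single y]
  have h (i j : d) : single i j (y i j) = y i j • single i j (1 : R) := by simp
  simp only [map_sum, h, map_smul, trace, diag, mul_apply, of_apply, smul_eq_mul]
  rw [Finset.sum_comm]
  simp only [mul_comm]

open scoped MatrixOrder in
theorem PosSemidef.trace_mul_nonneg_s1 {d : Type*} [Fintype d] {s a : Matrix d d ℂ}
    (hs : s.PosSemidef) (ha : a.PosSemidef) : 0 ≤ (s * a).trace := by
  classical
  obtain ⟨B, rfl⟩ := CStarAlgebra.nonneg_iff_eq_star_mul_self.mp ha.nonneg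
  rw [star_eq_conjTranspose, ← mul_assoc, trace_mul_comm, ← mul_assoc]
  exact (hs.mul_mul_conjTranspose_same B).trace_nonneg

theorem posSemidef_of_forall_trace_mul_nonneg {d : Type*} [Fintype d] {s : Matrix d d ℂ}
    (h : ∀ a : Matrix d d ℂ, a.PosSemidef → 0 ≤ (s * a).trace) : s.PosSemidef := by
  classical
  have key (v : d → ℂ) : 0 ≤ star v ⬝ᵥ s *ᵥ v := by
    have := h _ (posSemidef_vecMulVec_self_star v)
    rwa [mul_vecMulVec, trace_vecMulVec, dotProduct_comm] at this
  rw [← isPositive_toEuclideanLin_iff, LinearMap.isPositive_iff_complex]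
  intro v
  have hv := key v.ofLp
  have hin : inner ℂ (s.toEuclideanLin v) v = star (star v.ofLp ⬝ᵥ s *ᵥ v.ofLp) := by
    rw [EuclideanSpace.inner_eq_star_dotProduct, ← star_dotProduct, dotProduct_comm]
    rfl
  rw [hin, (IsSelfAdjoint.of_nonneg hv).star_eq]
  obtain ⟨hre, him⟩ := Complex.nonneg_iff.1 hv
  exact ⟨Complex.ext rfl (by simpa using him), hre⟩

theorem isPosFun_iff_exists_posSemidef {d : Type*} [Fintype d] {σ : Matrix d d ℂ →ₗ[ℂ] ℂ} :
    IsPosFun σ ↔ ∃ s : Matrix d d ℂ, s.PosSemidef ∧ ∀ y, σ y = (s * y).trace := by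
  classical
  constructor
  · intro h
    obtain ⟨s, hs⟩ := exists_forall_eq_trace_mul σ
    exact ⟨s, posSemidef_of_forall_trace_mul_nonneg fun a ha ↦ hs a ▸ h a ha, hs⟩
  · rintro ⟨s, hs, h⟩ a ha
    exact h a ▸ hs.trace_mul_nonneg_s1 ha

/-- Two linear functionals agreeing on Kronecker products are equal. -/
theorem kronecker_linearMap_ext {n m R M : Type*} [CommSemiring R] [AddCommMonoid M] [Module R M]
    [Fintype n] [DecidableEq n] [Fintype m] [DecidableEq m]
    {f g : Matrix (n × m) (n × m) R →ₗ[R] M} (h : ∀ a b, f (a ⊗ₖ b) = g (a ⊗ₖ b)) : f = g := by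
  refine ext_linearMap _ fun i k ↦ LinearMap.ext_ring ?_
  simpa [single_kronecker_single] using h (single i.1 k.1 1) (single i.2 k.2 1)

/-- The set of density matrices: positive semidefinite matrices of trace one. -/
def densityMatrices (d : Type*) [Fintype d] : Set (Matrix d d ℂ) :=
  {P | P.PosSemidef ∧ P.trace = 1}

open scoped Matrix.Norms.Frobenius in
theorem trace_conjTranspose_mul_self_eq_norm_sq {d : Type*} [Fintype d] (A : Matrix d d ℂ) :
    (Aᴴ * A).trace = ((‖A‖ ^ 2 : ℝ) : ℂ) := by
  have h : ‖A‖ ^ 2 = ∑ i, ∑ j, ‖A i j‖ ^ 2 := by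
    rw [frobenius_norm_def, ← Real.sqrt_eq_rpow, Real.sq_sqrt (by positivity)]
    simp
  rw [h, Finset.sum_comm]
  simp [trace, mul_apply, Complex.conj_mul']

open scoped Matrix.Norms.Frobenius MatrixOrder in
theorem densityMatrices_eq_image_sphere (d : Type*) [Fintype d] :
    densityMatrices d = (fun A : Matrix d d ℂ ↦ Aᴴ * A) '' Metric.sphere 0 1 := by
  classical
  ext P
  constructor
  · rintro ⟨hP, htr⟩
    obtain ⟨B, rfl⟩ := CStarAlgebra.nonneg_iff_eq_star_mul_self.mp hP.nonneg
    refine ⟨B, ?_, rfl⟩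
    rw [star_eq_conjTranspose, trace_conjTranspose_mul_self_eq_norm_sq] at htr
    have : ‖B‖ ^ 2 = 1 := by exact_mod_cast htr
    exact mem_sphere_zero_iff_norm.2
        ((pow_eq_one_iff_of_nonneg (norm_nonneg B) two_ne_zero).1 this)
  · rintro ⟨A, hA, rfl⟩
    refine ⟨posSemidef_conjTranspose_mul_self A, ?_⟩
    rw [trace_conjTranspose_mul_self_eq_norm_sq, mem_sphere_zero_iff_norm.1 hA]
    simp

theorem isCompact_densityMatrices (d : Type*) [Fintype d] : IsCompact (densityMatrices d) := by
  open scoped Matrix.Norms.Frobenius in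
  rw [densityMatrices_eq_image_sphere]
  have : ProperSpace (Matrix d d ℂ) := FiniteDimensional.proper ℂ _
  exact (isCompact_sphere _ _).image
    (continuous_id.matrix_conjTranspose.matrix_mul continuous_id)

/-- A nonzero positive semidefinite matrix is a positive multiple of a density matrix. -/
theorem PosSemidef.exists_eq_smul_densityMatrix {d : Type*} [Fintype d] {a : Matrix d d ℂ}
    (ha : a.PosSemidef) : a = 0 ∨ ∃ P ∈ densityMatrices d, ∃ r : ℝ, 0 < r ∧ a = r • P := by
  by_cases h0 : a.trace = 0
  · exact .inl (ha.trace_eq_zero_iff.1 h0)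
  have hpos : 0 < a.trace := lt_of_le_of_ne ha.trace_nonneg (Ne.symm h0)
  obtain ⟨hre, him⟩ := Complex.pos_iff.1 hpos
  have htr : a.trace = (a.trace.re : ℂ) := Complex.ext rfl (by simp [← him])
  refine .inr ⟨a.trace.re⁻¹ • a, ⟨ha.smul (by positivity), ?_⟩, a.trace.re, hre, ?_⟩
  · rw [trace_smul, Complex.real_smul]
    conv_lhs => rw [htr]
    rw [Complex.ofReal_re, ← Complex.ofReal_mul, inv_mul_cancel₀ hre.ne', Complex.ofReal_one]
  · rw [smul_smul, mul_inv_cancel₀ hre.ne', one_smul]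

/-- Kronecker products of density matrices. -/
def productStates (n m : Type*) [Fintype n] [Fintype m] : Set (Matrix (n × m) (n × m) ℂ) :=
  Set.image2 (· ⊗ₖ ·) (densityMatrices n) (densityMatrices m)

theorem isCompact_productStates (n m : Type*) [Fintype n] [Fintype m] :
    IsCompact (productStates n m) := by
  rw [productStates, ← Set.image_prod]
  refine ((isCompact_densityMatrices n).prod (isCompact_densityMatrices m)).image ?_
  refine continuous_matrix fun i j ↦ ?_
  exact (continuous_fst.matrix_elem _ _).mul (continuous_snd.matrix_elem _ _)

/-- A Hermitian matrix of trace one outside the convex hull of the product states is detected by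
a Hermitian block-positive matrix. -/
theorem exists_blockPositive_trace_mul_neg {n m : Type*} [Fintype n] [Fintype m]
    {D : Matrix (n × m) (n × m) ℂ} (hD : D.IsHermitian) (htr : D.trace = 1)
    (hmem : D ∉ convexHull ℝ (productStates n m)) :
    ∃ x : Matrix (n × m) (n × m) ℂ, x.IsHermitian ∧
      (∀ (a : Matrix n n ℂ) (b : Matrix m m ℂ), a.PosSemidef → b.PosSemidef →
        0 ≤ (x * (a ⊗ₖ b)).trace) ∧ (x * D).trace < 0 := by
  classical
  have : LocallyConvexSpace ℝ (Matrix (n × m) (n × m) ℂ) :=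
    inferInstanceAs (LocallyConvexSpace ℝ (n × m → n × m → ℂ))
  obtain ⟨f, u, hfD, hf⟩ := RCLike.geometric_hahn_banach_point_closed (𝕜 := ℂ)
    (convex_convexHull ℝ (productStates n m))
    (isCompact_productStates n m).convexHull_of_finiteDimensional.isClosed hmem
  obtain ⟨z, hz⟩ := exists_forall_eq_trace_mul (f : Matrix (n × m) (n × m) ℂ →ₗ[ℂ] ℂ)
  have htrace (y : Matrix (n × m) (n × m) ℂ) (hy : y.IsHermitian) (hy1 : y.trace = 1) :
      ((z + zᴴ - ((2 * u : ℝ) : ℂ) • 1) * y).trace = ((2 * ((f y).re - u) : ℝ) : ℂ) := by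
    have h1 : (zᴴ * y).trace = star (z * y).trace := by
      rw [← trace_conjTranspose, conjTranspose_mul, hy.eq, trace_mul_comm]
    have h2 : f y = (z * y).trace := hz y
    rw [sub_mul, add_mul, trace_sub, trace_add, h1, smul_mul_assoc, one_mul, trace_smul, hy1, h2]
    apply Complex.ext <;> simp
    ring
  refine ⟨z + zᴴ - ((2 * u : ℝ) : ℂ) • 1, ?_, fun a b ha hb ↦ ?_, ?_⟩
  · simp [IsHermitian, add_comm]
  · obtain rfl | ⟨P, hP, r, hr, rfl⟩ := ha.exists_eq_smul_densityMatrix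
    · simp
    obtain rfl | ⟨Q, hQ, t, ht, rfl⟩ := hb.exists_eq_smul_densityMatrix
    · simp
    have hPQ := hf _ (subset_convexHull ℝ _ (Set.mem_image2_of_mem hP hQ))
    rw [smul_kronecker, kronecker_smul, mul_smul_comm, mul_smul_comm, trace_smul, trace_smul,
      htrace _ (hP.1.kronecker hQ.1).isHermitian (by rw [trace_kronecker, hP.2, hQ.2, one_mul]),
      Complex.real_smul, Complex.real_smul, ← Complex.ofReal_mul, ← Complex.ofReal_mul]
    have : u < (f (P ⊗ₖ Q)).re := hPQ
    have : 0 < (f (P ⊗ₖ Q)).re - u := by linarith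
    exact_mod_cast (by positivity : 0 ≤ r * (t * (2 * ((f (P ⊗ₖ Q)).re - u))))
  · rw [htrace D hD htr]
    have : (f D).re < u := hfD
    exact_mod_cast (by linarith : 2 * ((f D).re - u) < 0)

/-- A functional represented by a convex combination of product states is separable. -/
theorem isSepFun_of_mem_convexHull {n m : ℕ}
    {ρ : Matrix (Fin n × Fin m) (Fin n × Fin m) ℂ →ₗ[ℂ] ℂ}
    {D : Matrix (Fin n × Fin m) (Fin n × Fin m) ℂ} {c : ℝ} (hc : 0 ≤ c)
    (hD : D ∈ convexHull ℝ (productStates (Fin n) (Fin m)))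
    (hρ : ∀ y, ρ y = ((c • D) * y).trace) : IsSepFun n m ρ := by
  obtain ⟨ι, _, w, z, hw, -, hz, rfl⟩ := mem_convexHull_iff_exists_fintype.1 hD
  choose P hP Q hQ hPQ using hz
  let e := (Fintype.equivFin ι).symm
  let F {d : ℕ} (s : Matrix (Fin d) (Fin d) ℂ) : Matrix (Fin d) (Fin d) ℂ →ₗ[ℂ] ℂ :=
    traceLinearMap _ ℂ ℂ ∘ₗ LinearMap.mulLeft ℂ s
  refine ⟨_, fun i ↦ F ((c * w (e i)) • P (e i)), fun i ↦ F (Q (e i)),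
    fun i ↦ isPosFun_iff_exists_posSemidef.2
      ⟨_, (hP _).1.smul (mul_nonneg hc (hw _)), fun _ ↦ rfl⟩,
    fun i ↦ isPosFun_iff_exists_posSemidef.2 ⟨_, (hQ _).1, fun _ ↦ rfl⟩, fun a b ↦ ?_⟩
  rw [hρ, e.sum_comp fun i ↦ F ((c * w i) • P i) a * F (Q i) b, Finset.smul_sum, Finset.sum_mul,
    trace_sum]
  refine Finset.sum_congr rfl fun i _ ↦ ?_
  rw [← hPQ i]
  simp [F, mul_smul, ← mul_kronecker_mul, trace_kronecker, mul_assoc]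

end Matrix

/-- The functional `φ̃(a ⊗ b) = Tr(φ(a) bᵀ)` associated to a linear map
`φ : M_n(ℂ) → M_m(ℂ)` is a separable positive linear functional if and only if
`φ̃(x) ≥ 0` for every Hermitian `x` that is block-positive, i.e. satisfies
`Tr(x (a ⊗ b)) ≥ 0` for all positive semidefinite `a`, `b`. -/
theorem separable_iff_nonneg_on_block_positive (n m : ℕ)
    (φ : Matrix (Fin n) (Fin n) ℂ →ₗ[ℂ] Matrix (Fin m) (Fin m) ℂ)
    (ρ : Matrix (Fin n × Fin m) (Fin n × Fin m) ℂ →ₗ[ℂ] ℂ)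
    (hρ : ∀ (a : Matrix (Fin n) (Fin n) ℂ) (b : Matrix (Fin m) (Fin m) ℂ),
      ρ (a ⊗ₖ b) = (φ a * bᵀ).trace) :
    IsSepFun n m ρ ↔
      ∀ x : Matrix (Fin n × Fin m) (Fin n × Fin m) ℂ, x.IsHermitian →
        (∀ (a : Matrix (Fin n) (Fin n) ℂ) (b : Matrix (Fin m) (Fin m) ℂ),
          a.PosSemidef → b.PosSemidef → 0 ≤ (x * (a ⊗ₖ b)).trace) →
        0 ≤ ρ x := by
  constructor
  · rintro ⟨k, σ, ω, hσ, hω, h⟩ x - hx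
    choose s hs hσs using fun i ↦ isPosFun_iff_exists_posSemidef.1 (hσ i)
    choose t ht hωt using fun i ↦ isPosFun_iff_exists_posSemidef.1 (hω i)
    have hρs : ρ = traceLinearMap _ ℂ ℂ ∘ₗ LinearMap.mulLeft ℂ (∑ i, s i ⊗ₖ t i) := by
      refine kronecker_linearMap_ext fun a b ↦ ?_
      simp [h, hσs, hωt, Finset.sum_mul, ← mul_kronecker_mul, trace_kronecker]
    rw [hρs]
    simp only [LinearMap.comp_apply, LinearMap.mulLeft_apply, traceLinearMap_apply,
      Finset.sum_mul, trace_sum]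
    refine Finset.sum_nonneg fun i _ ↦ ?_
    rw [trace_mul_comm]
    exact hx _ _ (hs i) (ht i)
  · intro h
    have hpos : IsPosFun ρ := fun x hx ↦ h x hx.isHermitian fun a b ha hb ↦
      hx.trace_mul_nonneg_s1 (ha.kronecker hb)
    obtain ⟨D, hD, hρD⟩ := isPosFun_iff_exists_posSemidef.1 hpos
    obtain rfl | ⟨E, hE, r, hr, rfl⟩ := hD.exists_eq_smul_densityMatrix
    · exact ⟨0, Fin.elim0, Fin.elim0, fun i ↦ i.elim0, fun i ↦ i.elim0, by simp [hρD]⟩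
    refine isSepFun_of_mem_convexHull hr.le (by_contra fun hE' ↦ ?_) hρD
    obtain ⟨x, hx, hxpos, hxneg⟩ := exists_blockPositive_trace_mul_neg hE.1.isHermitian hE.2 hE'
    have hρx := h x hx hxpos
    rw [hρD, trace_mul_comm, mul_smul_comm, trace_smul] at hρx
    exact hρx.not_gt (smul_neg_of_pos_of_neg hr hxneg)
end

section
/- Let φ : M_n(ℂ) → M_m(ℂ) be a positive linear map whose range consists of pairwise commuting matrices, i.e. φ(x)φ(y) = φ(y)φ(x) for all x, y ∈ M_n(ℂ). Then the associated functional φ̃ defined by φ̃(a ⊗ b) = Tr(φ(a) bᵀ) is a separable positive linear functional on M_n(ℂ) ⊗ M_m(ℂ). -/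
open Matrix
open scoped ComplexOrder Kronecker

open scoped MatrixOrder Matrix.Norms.L2Operator in
theorem Matrix.span_posSemidef_eq_top (d : Type*) [Fintype d] [DecidableEq d] :
    Submodule.span ℂ {a : Matrix d d ℂ | a.PosSemidef} = ⊤ := by
  simpa only [Matrix.nonneg_iff_posSemidef] using CStarAlgebra.span_nonneg (A := Matrix d d ℂ)

/-- A commuting family of symmetric operators on a finite-dimensional inner product space admits
an orthonormal basis of joint eigenvectors. -/
theorem LinearMap.IsSymmetric.exists_orthonormalBasis_of_pairwise_commute
    {𝕜 E ι : Type*} [RCLike 𝕜] [NormedAddCommGroup E] [InnerProductSpace 𝕜 E]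
    [FiniteDimensional 𝕜 E] {T : ι → E →ₗ[𝕜] E} (hT : ∀ i, (T i).IsSymmetric)
    (hC : ∀ i j, Commute (T i) (T j)) :
    ∃ b : OrthonormalBasis (Fin (Module.finrank 𝕜 E)) 𝕜 E,
      ∀ i k, ∃ μ : 𝕜, T i (b k) = μ • b k := by
  classical
  have hV := directSum_isInternal_of_pairwise_commute hT fun i j _ ↦ hC i j
  have hO := orthogonalFamily_iInf_eigenspaces hT
  have : Fintype {χ : ι → 𝕜 // (⨅ j, Module.End.eigenspace (T j) (χ j)) ≠ ⊥} :=
    (WellFoundedGT.finite_ne_bot_of_iSupIndep hV.submodule_iSupIndep).fintype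
  have hV' := DirectSum.isInternal_ne_bot_iff.mpr hV
  have hO' := hO.comp
    (Subtype.val_injective (p := fun χ : ι → 𝕜 ↦ (⨅ j, Module.End.eigenspace (T j) (χ j)) ≠ ⊥))
  refine ⟨hV'.subordinateOrthonormalBasis rfl hO', fun i k ↦ ?_⟩
  have hk := hV'.subordinateOrthonormalBasis_subordinate rfl k hO'
  exact ⟨_, Module.End.mem_eigenspace_iff.mp (Submodule.mem_iInf _ |>.mp hk i)⟩

/-- If `φ : M_n(ℂ) → M_m(ℂ)` is a positive linear map whose range
consists of pairwise commuting matrices, then the associated functional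
`φ̃(a ⊗ b) = Tr(φ(a) bᵀ)` is a separable positive linear functional. -/
theorem separable_of_commuting_range (n m : ℕ)
    (φ : Matrix (Fin n) (Fin n) ℂ →ₗ[ℂ] Matrix (Fin m) (Fin m) ℂ)
    (hpos : ∀ a : Matrix (Fin n) (Fin n) ℂ, a.PosSemidef → (φ a).PosSemidef)
    (hcomm : ∀ x y : Matrix (Fin n) (Fin n) ℂ, φ x * φ y = φ y * φ x)
    (ρ : Matrix (Fin n × Fin m) (Fin n × Fin m) ℂ →ₗ[ℂ] ℂ)
    (hρ : ∀ (a : Matrix (Fin n) (Fin n) ℂ) (b : Matrix (Fin m) (Fin m) ℂ),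
      ρ (a ⊗ₖ b) = (φ a * bᵀ).trace) :
    IsSepFun n m ρ := by
  let L := Matrix.toEuclideanLin (𝕜 := ℂ) (m := Fin m) (n := Fin m)
  have hmul (x y : Matrix (Fin m) (Fin m) ℂ) : L (x * y) = L x * L y :=
    Matrix.toLpLin_mul_same 2 x y
  obtain ⟨v, hv⟩ := LinearMap.IsSymmetric.exists_orthonormalBasis_of_pairwise_commute
    (T := fun a : {a : Matrix (Fin n) (Fin n) ℂ // a.PosSemidef} ↦ L (φ a))
    (fun a ↦ Matrix.isSymmetric_toEuclideanLin_iff.mpr (hpos a a.2).isHermitian)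
    (fun a b ↦ by rw [Commute, SemiconjBy, ← hmul, ← hmul, hcomm])
  let q (k) : Matrix (Fin m) (Fin m) ℂ →ₗ[ℂ] ℂ :=
    innerₛₗ ℂ (v k) ∘ₗ LinearMap.applyₗ (v k) ∘ₗ L.toLinearMap
  have hq (k) (x) : q k x = inner ℂ (v k) (L x (v k)) := rfl
  have hqpos (k) : IsPosFun (q k) := fun x hx ↦ by
    rw [hq]
    exact (Matrix.isPositive_toEuclideanLin_iff.mpr hx).inner_nonneg_right (v k)
  have heig (k) (a) : L (φ a) (v k) = q k (φ a) • v k := by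
    have ha : a ∈ Submodule.span ℂ {a : Matrix (Fin n) (Fin n) ℂ | a.PosSemidef} := by
      rw [Matrix.span_posSemidef_eq_top]; trivial
    induction ha using Submodule.span_induction with
    | mem a ha =>
      obtain ⟨μ, hμ⟩ := hv ⟨a, ha⟩ k
      simp only at hμ
      simp [hq, hμ, v.orthonormal.1 k]
    | zero => simp
    | add a b _ _ ha hb => simp [ha, hb, add_smul]
    | smul c a _ ha => simp [ha, mul_smul]
  refine ⟨_, fun k ↦ q k ∘ₗ φ, fun k ↦ q k ∘ₗ (Matrix.transposeLinearEquiv _ _ ℂ ℂ).toLinearMap,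
    fun k a ha ↦ hqpos k _ (hpos a ha), fun k b hb ↦ hqpos k _ hb.transpose, fun a b ↦ ?_⟩
  have htr (x : Matrix (Fin m) (Fin m) ℂ) : x.trace = LinearMap.trace ℂ _ (L x) := by
    rw [← Matrix.trace_toLin_eq x (PiLp.basisFun 2 ℂ (Fin m)), ← Matrix.toLpLin_eq_toLin]
  rw [hρ, Matrix.trace_mul_comm, htr, LinearMap.trace_eq_sum_inner _ v]
  refine Finset.sum_congr rfl fun k _ ↦ ?_
  rw [hmul, Module.End.mul_apply, heig, map_smul, inner_smul_right]
  rfl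
end

section
/- Let φ : M_n(ℂ) → M_m(ℂ) be a linear map and let φ̃ be the associated functional φ̃(a ⊗ b) = Tr(φ(a) bᵀ). Then φ̃ and φ̃ ∘ (ι ⊗ t) are both positive linear functionals (i.e. φ̃ satisfies the Peres condition) if and only if φ is both completely positive and copositive. -/
open Matrix
open scoped ComplexOrder Kronecker

/-- The map `ι_k ⊗ φ` applied blockwise to a matrix in `M_k(ℂ) ⊗ M_n(ℂ)`. -/
def idTensor {n m : ℕ} (k : ℕ)
    (φ : Matrix (Fin n) (Fin n) ℂ →ₗ[ℂ] Matrix (Fin m) (Fin m) ℂ)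
    (x : Matrix (Fin k × Fin n) (Fin k × Fin n) ℂ) :
    Matrix (Fin k × Fin m) (Fin k × Fin m) ℂ :=
  Matrix.of fun p q => φ (Matrix.of fun a b => x (p.1, a) (q.1, b)) p.2 q.2

/-- A linear map `φ : M_n(ℂ) → M_m(ℂ)` is completely positive if `ι_k ⊗ φ` maps positive
semidefinite matrices to positive semidefinite matrices for every `k`. -/
def IsCompletelyPositive {n m : ℕ}
    (φ : Matrix (Fin n) (Fin n) ℂ →ₗ[ℂ] Matrix (Fin m) (Fin m) ℂ) : Prop :=
  ∀ (k : ℕ) (x : Matrix (Fin k × Fin n) (Fin k × Fin n) ℂ),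
    x.PosSemidef → (idTensor k φ x).PosSemidef

/-- The transpose map on `M_m(ℂ)` as a linear map. -/
def transposeLM (m : ℕ) : Matrix (Fin m) (Fin m) ℂ →ₗ[ℂ] Matrix (Fin m) (Fin m) ℂ where
  toFun x := xᵀ
  map_add' x y := by ext i j; simp
  map_smul' c x := by ext i j; simp

/-- A linear map `φ` is copositive if `t ∘ φ` is completely positive. -/
def IsCopositive {n m : ℕ}
    (φ : Matrix (Fin n) (Fin n) ℂ →ₗ[ℂ] Matrix (Fin m) (Fin m) ℂ) : Prop :=
  IsCompletelyPositive (transposeLM m ∘ₗ φ)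

/-- The partial transpose `ι ⊗ t` on `M_n(ℂ) ⊗ M_m(ℂ)`, transposing the second factor. -/
def ptRight (n m : ℕ) (x : Matrix (Fin n × Fin m) (Fin n × Fin m) ℂ) :
    Matrix (Fin n × Fin m) (Fin n × Fin m) ℂ :=
  Matrix.of fun p q => x (p.1, q.2) (q.1, p.2)

/-- A complex matrix whose quadratic form is nonnegative is positive semidefinite. -/
theorem posSemidef_of_forall_quadraticForm_nonneg {ι : Type*} [Fintype ι]
    (A : Matrix ι ι ℂ) (h : ∀ v : ι → ℂ, 0 ≤ star v ⬝ᵥ (A *ᵥ v)) : A.PosSemidef := by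
  classical
  rw [← Matrix.isPositive_toEuclideanLin_iff, LinearMap.isPositive_iff_complex]
  intro x
  have key : 0 ≤ inner ℂ (toEuclideanLin A x) x := by
    have hx := star_nonneg_iff.2 (h x.ofLp)
    rw [star_dotProduct, star_star] at hx
    simpa [EuclideanSpace.inner_eq_star_dotProduct, dotProduct_comm] using hx
  obtain ⟨hre, him⟩ := Complex.nonneg_iff.1 key
  exact ⟨Complex.ext (by simp) (by simpa using him), by simpa using hre⟩

/-- The functional associated to `φ` sums the matrix entries `φ(x_{kl})_{kl}`, where `x_{kl}` is
the `(k, l)` block of `x` with respect to the second tensor factor. -/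
theorem functional_eq_sum_blocks {n m : ℕ}
    {φ : Matrix (Fin n) (Fin n) ℂ →ₗ[ℂ] Matrix (Fin m) (Fin m) ℂ}
    {ρ : Matrix (Fin n × Fin m) (Fin n × Fin m) ℂ →ₗ[ℂ] ℂ}
    (hρ : ∀ (a : Matrix (Fin n) (Fin n) ℂ) (b : Matrix (Fin m) (Fin m) ℂ),
      ρ (a ⊗ₖ b) = (φ a * bᵀ).trace)
    (x : Matrix (Fin n × Fin m) (Fin n × Fin m) ℂ) :
    ρ x = ∑ k, ∑ l, φ (Matrix.of fun i j => x (i, k) (j, l)) k l := by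
  have hx : x = ∑ k, ∑ l,
      (Matrix.of fun i j => x (i, k) (j, l)) ⊗ₖ (Matrix.single k l (1 : ℂ)) := by
    ext ⟨i, k⟩ ⟨j, l⟩
    simp [Matrix.sum_apply, Matrix.single_apply, ite_and]
  conv_lhs => rw [hx]
  simp only [map_sum, hρ, Matrix.transpose_single, Matrix.trace_mul_single,
    MulOpposite.op_one, one_smul]

/-- The Choi correspondence: the functional associated to `φ` is positive if and only if `φ` is
completely positive. -/
theorem functional_nonneg_iff_isCompletelyPositive {n m : ℕ}
    {φ : Matrix (Fin n) (Fin n) ℂ →ₗ[ℂ] Matrix (Fin m) (Fin m) ℂ}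
    {ρ : Matrix (Fin n × Fin m) (Fin n × Fin m) ℂ →ₗ[ℂ] ℂ}
    (hρ : ∀ (a : Matrix (Fin n) (Fin n) ℂ) (b : Matrix (Fin m) (Fin m) ℂ),
      ρ (a ⊗ₖ b) = (φ a * bᵀ).trace) :
    (∀ x : Matrix (Fin n × Fin m) (Fin n × Fin m) ℂ, x.PosSemidef → 0 ≤ ρ x) ↔
      IsCompletelyPositive φ := by
  constructor
  · intro h k x hx
    refine posSemidef_of_forall_quadraticForm_nonneg _ fun v => ?_
    let B : Matrix (Fin k × Fin n) (Fin n × Fin m) ℂ :=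
      Matrix.of fun p q => if p.2 = q.1 then v (p.1, q.2) else 0
    have hblock (r s : Fin m) :
        (Matrix.of fun i j => (Bᴴ * x * B) (i, r) (j, s)) =
          ∑ p, ∑ q, (star (v (p, r)) * v (q, s)) • Matrix.of fun i j => x (p, i) (q, j) := by
      ext i j
      simp only [B, Matrix.mul_apply, Fintype.sum_prod_type, Matrix.conjTranspose_apply,
        Matrix.of_apply, Matrix.sum_apply, Matrix.smul_apply, smul_eq_mul, apply_ite star,
        star_zero, ite_mul, zero_mul, mul_ite, mul_zero, Finset.sum_ite_eq', Finset.mem_univ,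
        if_true, Finset.sum_mul]
      rw [Finset.sum_comm]
      exact Finset.sum_congr rfl fun p _ => Finset.sum_congr rfl fun q _ => by ring
    have hpos := h _ (hx.conjTranspose_mul_mul_same B)
    rw [functional_eq_sum_blocks hρ] at hpos
    convert hpos using 1
    simp only [hblock, map_sum, map_smul, Matrix.sum_apply, Matrix.smul_apply, smul_eq_mul,
      dotProduct, mulVec, Fintype.sum_prod_type, Pi.star_apply, idTensor, Matrix.of_apply,
      Finset.mul_sum]
    rw [Finset.sum_comm]
    refine Finset.sum_congr rfl fun r _ => ?_
    refine (Finset.sum_congr rfl fun p _ => Finset.sum_comm).trans (Finset.sum_comm.trans ?_)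
    exact Finset.sum_congr rfl fun s _ => Finset.sum_congr rfl fun p _ =>
      Finset.sum_congr rfl fun q _ => by ring
  · intro h x hx
    have hpos := (h m _ (hx.submatrix Prod.swap)).dotProduct_mulVec_nonneg
      fun p => if p.1 = p.2 then 1 else 0
    rw [functional_eq_sum_blocks hρ]
    simpa [dotProduct, mulVec, Fintype.sum_prod_type, idTensor, apply_ite star] using hpos

/-- The functional `φ̃(a ⊗ b) = Tr(φ(a) bᵀ)` satisfies the Peres
condition (both `φ̃` and `φ̃ ∘ (ι ⊗ t)` are positive linear functionals) if and only if
`φ` is both completely positive and copositive. -/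
theorem peres_iff_cp_and_copositive (n m : ℕ)
    (φ : Matrix (Fin n) (Fin n) ℂ →ₗ[ℂ] Matrix (Fin m) (Fin m) ℂ)
    (ρ : Matrix (Fin n × Fin m) (Fin n × Fin m) ℂ →ₗ[ℂ] ℂ)
    (hρ : ∀ (a : Matrix (Fin n) (Fin n) ℂ) (b : Matrix (Fin m) (Fin m) ℂ),
      ρ (a ⊗ₖ b) = (φ a * bᵀ).trace) :
    ((∀ x : Matrix (Fin n × Fin m) (Fin n × Fin m) ℂ, x.PosSemidef → 0 ≤ ρ x) ∧
      (∀ x : Matrix (Fin n × Fin m) (Fin n × Fin m) ℂ, x.PosSemidef →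
        0 ≤ ρ (ptRight n m x))) ↔
      IsCompletelyPositive φ ∧ IsCopositive φ := by
  have hρt (a : Matrix (Fin n) (Fin n) ℂ) (b : Matrix (Fin m) (Fin m) ℂ) :
      ρ (ptRight n m (a ⊗ₖ b)) = ((transposeLM m ∘ₗ φ) a * bᵀ).trace := by
    have hpt : ptRight n m (a ⊗ₖ b) = a ⊗ₖ bᵀ := rfl
    rw [hpt, hρ, Matrix.transpose_transpose, ← Matrix.trace_transpose, Matrix.transpose_mul,
      Matrix.trace_mul_comm]
    rfl
  let ptRightLM : Matrix (Fin n × Fin m) (Fin n × Fin m) ℂ →ₗ[ℂ]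
      Matrix (Fin n × Fin m) (Fin n × Fin m) ℂ :=
    { toFun := ptRight n m
      map_add' := fun _ _ => rfl
      map_smul' := fun _ _ => rfl }
  exact and_congr (functional_nonneg_iff_isCompletelyPositive hρ)
    (functional_nonneg_iff_isCompletelyPositive (ρ := ρ ∘ₗ ptRightLM) hρt)
end

section
/- Let h ∈ M_n(ℂ) ⊗ M_m(ℂ) be the density matrix of a state ρ on M_n(ℂ) ⊗ M_m(ℂ). Then ρ is separable if and only if (ι ⊗ ψ)(h) is positive semidefinite for every positive linear map ψ : M_m(ℂ) → M_n(ℂ). -/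
open Matrix
open scoped ComplexOrder Kronecker

/-- The map `ι ⊗ ψ` applied blockwise to a matrix in `M_n(ℂ) ⊗ M_m(ℂ)`, where
`ψ : M_m(ℂ) → M_p(ℂ)` acts on the second tensor factor. -/
def mapRight {n m p : ℕ}
    (ψ : Matrix (Fin m) (Fin m) ℂ →ₗ[ℂ] Matrix (Fin p) (Fin p) ℂ)
    (h : Matrix (Fin n × Fin m) (Fin n × Fin m) ℂ) :
    Matrix (Fin n × Fin p) (Fin n × Fin p) ℂ :=
  Matrix.of fun q r => ψ (Matrix.of fun s t => h (q.1, s) (r.1, t)) q.2 r.2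

theorem isCompact_convexHull_of_finiteDimensional {E : Type*} [AddCommGroup E] [Module ℝ E]
    [TopologicalSpace E] [ContinuousAdd E] [ContinuousSMul ℝ E] [FiniteDimensional ℝ E]
    {s : Set E} (hs : IsCompact s) : IsCompact (convexHull ℝ s) := by
  rcases s.eq_empty_or_nonempty with rfl | ⟨x₀, hx₀⟩
  · simp
  let N := Module.finrank ℝ E + 1
  let F : (Fin N → ℝ) × (Fin N → E) → E := fun p => ∑ j, p.1 j • p.2 j
  have hF : Continuous F := by fun_prop
  have hcomp : IsCompact (F '' (stdSimplex ℝ (Fin N) ×ˢ Set.univ.pi fun _ => s)) :=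
    ((isCompact_stdSimplex ℝ (Fin N)).prod (isCompact_univ_pi fun _ => hs)).image hF
  convert hcomp using 1
  apply Set.Subset.antisymm
  · intro x hx
    obtain ⟨ι, _, z, w, hz, hind, hw, hw1, rfl⟩ := eq_pos_convex_span_of_mem_convexHull hx
    have hcard : Fintype.card ι ≤ Fintype.card (Fin N) := by
      rw [Fintype.card_fin]
      exact hind.card_le_finrank_succ.trans (Nat.succ_le_succ (Submodule.finrank_le _))
    obtain ⟨e⟩ := Function.Embedding.nonempty_of_card_le hcard
    have hnot : ∀ j, j ∉ Set.range e → Function.extend e w 0 j = 0 := fun j hj => by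
      rw [Function.extend_apply' _ _ _ (by simpa using hj)]; rfl
    refine ⟨(Function.extend e w 0, Function.extend e z fun _ => x₀), ⟨⟨fun j => ?_, ?_⟩, ?_⟩, ?_⟩
    · by_cases hj : j ∈ Set.range e
      · obtain ⟨i, rfl⟩ := hj
        simpa [e.injective.extend_apply] using (hw i).le
      · exact (hnot j hj).ge
    · rw [← hw1]
      exact (Fintype.sum_of_injective e e.injective _ _ hnot
        fun i => (e.injective.extend_apply _ _ _).symm).symm
    · intro j _
      by_cases hj : j ∈ Set.range e
      · obtain ⟨i, rfl⟩ := hj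
        simpa [e.injective.extend_apply] using hz ⟨i, rfl⟩
      · simpa [Function.extend_apply' _ _ _ (show ¬∃ a, e a = j by simpa using hj)] using hx₀
    · refine (Fintype.sum_of_injective e e.injective _ _ (fun j hj => ?_) fun i => ?_).symm
      · simp [hnot j hj]
      · simp [e.injective.extend_apply]
  · rintro _ ⟨⟨w, z⟩, ⟨⟨hw0, hw1⟩, hz⟩, rfl⟩
    exact mem_convexHull_of_exists_fintype w z hw0 hw1 (fun j => hz j trivial) rfl

/-- The unnormalized density matrix of the product vector `v ⊗ w`. -/
def productProjection {n m : ℕ} (v : Fin n → ℂ) (w : Fin m → ℂ) :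
    Matrix (Fin n × Fin m) (Fin n × Fin m) ℂ :=
  vecMulVec v (star v) ⊗ₖ vecMulVec w (star w)

/-- The density matrices of pure product states. -/
def pureProductStates (n m : ℕ) : Set (Matrix (Fin n × Fin m) (Fin n × Fin m) ℂ) :=
  (fun p : EuclideanSpace ℂ (Fin n) × EuclideanSpace ℂ (Fin m) =>
    productProjection p.1.ofLp p.2.ofLp) '' (Metric.sphere 0 1 ×ˢ Metric.sphere 0 1)

theorem isCompact_pureProductStates (n m : ℕ) : IsCompact (pureProductStates n m) := by
  refine ((isCompact_sphere 0 1).prod (isCompact_sphere 0 1)).image ?_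
  refine continuous_matrix fun i j => ?_
  simp only [productProjection, kroneckerMap_apply, vecMulVec_apply, Pi.star_apply]
  fun_prop

theorem conjTranspose_productProjection {n m : ℕ} (v : Fin n → ℂ) (w : Fin m → ℂ) :
    (productProjection v w)ᴴ = productProjection v w := by
  simp [productProjection, conjTranspose_kronecker, conjTranspose_vecMulVec]

theorem productProjection_smul {n m : ℕ} (r s : ℝ) (v : Fin n → ℂ) (w : Fin m → ℂ) :
    productProjection ((r : ℂ) • v) ((s : ℂ) • w) =
      ((r ^ 2 * s ^ 2 : ℝ) : ℂ) • productProjection v w := by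
  ext i j
  simp [productProjection, vecMulVec_apply]
  ring

theorem trace_of_mem_pureProductStates {n m : ℕ}
    {x : Matrix (Fin n × Fin m) (Fin n × Fin m) ℂ} (hx : x ∈ pureProductStates n m) :
    x.trace = 1 := by
  obtain ⟨⟨v, w⟩, ⟨hv, hw⟩, rfl⟩ := hx
  have key : ∀ {k : ℕ} (u : EuclideanSpace ℂ (Fin k)), ‖u‖ = 1 → u.ofLp ⬝ᵥ star u.ofLp = 1 := by
    intro k u hu
    rw [← EuclideanSpace.inner_eq_star_dotProduct, inner_self_eq_norm_sq_to_K, hu]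
    simp
  simp only [mem_sphere_zero_iff_norm] at hv hw
  simp [productProjection, trace_kronecker, trace_vecMulVec, key v hv, key w hw]

theorem exists_sum_kronecker_of_mem_convexHull {n m : ℕ}
    {h : Matrix (Fin n × Fin m) (Fin n × Fin m) ℂ}
    (hh : h ∈ convexHull ℝ (pureProductStates n m)) :
    ∃ (k : ℕ) (a : Fin k → Matrix (Fin n) (Fin n) ℂ) (b : Fin k → Matrix (Fin m) (Fin m) ℂ),
      (∀ i, (a i).PosSemidef) ∧ (∀ i, (b i).PosSemidef) ∧ h = ∑ i, a i ⊗ₖ b i := by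
  obtain ⟨ι, _, c, z, hc, -, hz, rfl⟩ := mem_convexHull_iff_exists_fintype.1 hh
  choose p hp hpz using hz
  let e := (Fintype.equivFin ι).symm
  refine ⟨Fintype.card ι,
    fun i => c (e i) • vecMulVec (p (e i)).1.ofLp (star (p (e i)).1.ofLp),
    fun i => vecMulVec (p (e i)).2.ofLp (star (p (e i)).2.ofLp),
    fun i => (posSemidef_vecMulVec_self_star _).smul (hc _),
    fun i => posSemidef_vecMulVec_self_star _, ?_⟩
  rw [← e.sum_comp]
  refine Finset.sum_congr rfl fun i _ => ?_
  rw [← hpz, smul_kronecker]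
  rfl

theorem exists_entanglement_witness {n m : ℕ}
    {h : Matrix (Fin n × Fin m) (Fin n × Fin m) ℂ} (hherm : h.IsHermitian) (htr : h.trace = 1)
    (hh : h ∉ convexHull ℝ (pureProductStates n m)) :
    ∃ G : Matrix (Fin n × Fin m) (Fin n × Fin m) ℂ →ₗ[ℂ] ℂ,
      (∀ x, G xᴴ = star (G x)) ∧ (∀ v w, 0 ≤ G (productProjection v w)) ∧ ¬ 0 ≤ G h := by
  have : LocallyConvexSpace ℝ (Matrix (Fin n × Fin m) (Fin n × Fin m) ℂ) :=
    inferInstanceAs (LocallyConvexSpace ℝ (Fin n × Fin m → Fin n × Fin m → ℂ))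
  obtain ⟨f, u, hfK, hfh⟩ := RCLike.geometric_hahn_banach_closed_point (𝕜 := ℂ)
    (convex_convexHull ℝ (pureProductStates n m))
    (isCompact_convexHull_of_finiteDimensional (isCompact_pureProductStates n m)).isClosed hh
  let G : Matrix (Fin n × Fin m) (Fin n × Fin m) ℂ →ₗ[ℂ] ℂ :=
    { toFun := fun x => 2 * u * x.trace - f x - star (f xᴴ)
      map_add' := fun x y => by simp; ring
      map_smul' := fun c x => by simp; ring }
  have hG : ∀ x : Matrix (Fin n × Fin m) (Fin n × Fin m) ℂ, xᴴ = x → x.trace = 1 →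
      G x = ((2 * (u - (f x).re) : ℝ) : ℂ) := by
    intro x hx hx1
    have h2 := Complex.add_conj (f x)
    change 2 * u * x.trace - f x - star (f xᴴ) = _
    rw [hx, hx1, Complex.star_def]
    push_cast at h2 ⊢
    linear_combination -h2
  refine ⟨G, fun x => ?_, fun v w => ?_, ?_⟩
  · change 2 * u * xᴴ.trace - f xᴴ - star (f xᴴᴴ) = star (2 * u * x.trace - f x - star (f xᴴ))
    simp [trace_conjTranspose]
    ring
  · have hunit : ∀ x ∈ pureProductStates n m, xᴴ = x → 0 ≤ G x := fun x hx hx' => by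
      rw [hG x hx' (trace_of_mem_pureProductStates hx), Complex.zero_le_real]
      have := hfK x (subset_convexHull ℝ _ hx)
      simp only [RCLike.re_eq_complex_re] at this
      linarith
    have hscale : ∀ {k : ℕ} (y : Fin k → ℂ), y = 0 ∨
        ∃ (r : ℝ) (z : EuclideanSpace ℂ (Fin k)), ‖z‖ = 1 ∧ y = (r : ℂ) • z.ofLp := by
      intro k y
      refine or_iff_not_imp_left.2 fun hy => ⟨‖WithLp.toLp 2 y‖,
        ((‖WithLp.toLp 2 y‖⁻¹ : ℝ) : ℂ) • WithLp.toLp 2 y, ?_, ?_⟩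
      · have hy' : ‖WithLp.toLp 2 y‖ ≠ 0 := by simpa using hy
        rw [norm_smul]; simp [hy']
      · have hy' : (‖WithLp.toLp 2 y‖ : ℂ) ≠ 0 := by simpa using hy
        simp [smul_smul, hy']
    rcases hscale v with rfl | ⟨r, v', hv', rfl⟩
    · simp [productProjection]
    rcases hscale w with rfl | ⟨s, w', hw', rfl⟩
    · simp [productProjection]
    rw [productProjection_smul, map_smul, smul_eq_mul]
    refine mul_nonneg (Complex.zero_le_real.2 (by positivity))
      (hunit _ ⟨(v', w'), ⟨by simpa using hv', by simpa using hw'⟩, rfl⟩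
        (conjTranspose_productProjection _ _))
  · rw [hG h hherm htr, Complex.zero_le_real]
    simp only [RCLike.re_eq_complex_re] at hfh
    linarith

/-- The map `b ↦ (G (E_{ij} ⊗ b))_{ij}` associated with a functional `G` on the tensor product. -/
def choiMap {n m : ℕ} (G : Matrix (Fin n × Fin m) (Fin n × Fin m) ℂ →ₗ[ℂ] ℂ) :
    Matrix (Fin m) (Fin m) ℂ →ₗ[ℂ] Matrix (Fin n) (Fin n) ℂ where
  toFun b := Matrix.of fun i j => G (single i j 1 ⊗ₖ b)
  map_add' b c := by ext; simp [kronecker_add]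
  map_smul' r b := by ext; simp [kronecker_smul]

theorem posSemidef_choiMap {n m : ℕ} {G : Matrix (Fin n × Fin m) (Fin n × Fin m) ℂ →ₗ[ℂ] ℂ}
    (hstar : ∀ x, G xᴴ = star (G x)) (hpos : ∀ v w, 0 ≤ G (productProjection v w))
    {b : Matrix (Fin m) (Fin m) ℂ} (hb : b.PosSemidef) : (choiMap G b).PosSemidef := by
  refine .of_dotProduct_mulVec_nonneg ?_ fun v => ?_
  · ext i j
    simp [choiMap, ← hstar, conjTranspose_kronecker, hb.1.eq]
  · have hval : star v ⬝ᵥ (choiMap G b *ᵥ v) = G (vecMulVec (star v) v ⊗ₖ b) := by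
      have hdec : vecMulVec (star v) v ⊗ₖ b =
          ∑ i, ∑ j, (star v i * v j) • (single i j (1 : ℂ) ⊗ₖ b) := by
        ext ⟨i, s⟩ ⟨j, t⟩
        simp [Matrix.sum_apply, vecMulVec_apply, single_apply, ite_and]
      rw [hdec]
      simp only [map_sum, map_smul, dotProduct, mulVec, Finset.mul_sum, choiMap]
      simp [mul_comm, mul_assoc, mul_left_comm]
    obtain ⟨N, c, rfl⟩ := posSemidef_iff_eq_sum_vecMulVec.1 hb
    have hdec : vecMulVec (star v) v ⊗ₖ (∑ k, vecMulVec (c k) (star (c k))) =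
        ∑ k, productProjection (star v) (c k) := by
      ext ⟨i, s⟩ ⟨j, t⟩
      simp [Matrix.sum_apply, productProjection, vecMulVec_apply, Finset.mul_sum]
    rw [hval, hdec, map_sum]
    exact Finset.sum_nonneg fun k _ => hpos _ _

theorem nonneg_of_mapRight_choiMap {n m : ℕ}
    (G : Matrix (Fin n × Fin m) (Fin n × Fin m) ℂ →ₗ[ℂ] ℂ)
    {h : Matrix (Fin n × Fin m) (Fin n × Fin m) ℂ}
    (hh : (mapRight (choiMap G) h).PosSemidef) : 0 ≤ G h := by
  have hdec : h = ∑ i, ∑ j,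
      single i j (1 : ℂ) ⊗ₖ (Matrix.of fun s t => h (i, s) (j, t)) := by
    ext ⟨i, s⟩ ⟨j, t⟩
    simp [Matrix.sum_apply, single_apply, ite_and]
  have := hh.dotProduct_mulVec_nonneg (fun q => if q.1 = q.2 then 1 else 0)
  rw [hdec]
  simpa [dotProduct, mulVec, Fintype.sum_prod_type, mapRight, choiMap] using this

theorem mapRight_sum_kronecker {n m p k : ℕ}
    (ψ : Matrix (Fin m) (Fin m) ℂ →ₗ[ℂ] Matrix (Fin p) (Fin p) ℂ)
    (a : Fin k → Matrix (Fin n) (Fin n) ℂ) (b : Fin k → Matrix (Fin m) (Fin m) ℂ) :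
    mapRight ψ (∑ i, a i ⊗ₖ b i) = ∑ i, a i ⊗ₖ ψ (b i) := by
  ext ⟨i, s⟩ ⟨j, t⟩
  have : (Matrix.of fun s t => (∑ l, a l ⊗ₖ b l) (i, s) (j, t)) = ∑ l, a l i j • b l := by
    ext s t
    simp [Matrix.sum_apply]
  simp only [mapRight, of_apply, this]
  simp [Matrix.sum_apply]

/-- **Horodecki criterion.** A state on `M_n(ℂ) ⊗ M_m(ℂ)` with density
matrix `h` is separable (i.e. `h = Σ_k a_k ⊗ b_k` with `a_k`, `b_k` positive
semidefinite) if and only if `(ι ⊗ ψ)(h)` is positive semidefinite for every positive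
linear map `ψ : M_m(ℂ) → M_n(ℂ)`. -/
theorem separable_iff_mapRight_posSemidef (n m : ℕ)
    (h : Matrix (Fin n × Fin m) (Fin n × Fin m) ℂ)
    (hpsd : h.PosSemidef) (htr : h.trace = 1) :
    (∃ (k : ℕ) (a : Fin k → Matrix (Fin n) (Fin n) ℂ)
        (b : Fin k → Matrix (Fin m) (Fin m) ℂ),
        (∀ i, (a i).PosSemidef) ∧ (∀ i, (b i).PosSemidef) ∧
        h = ∑ i, a i ⊗ₖ b i) ↔
      (∀ ψ : Matrix (Fin m) (Fin m) ℂ →ₗ[ℂ] Matrix (Fin n) (Fin n) ℂ,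
        (∀ b : Matrix (Fin m) (Fin m) ℂ, b.PosSemidef → (ψ b).PosSemidef) →
        (mapRight ψ h).PosSemidef) := by
  constructor
  · rintro ⟨k, a, b, ha, hb, rfl⟩ ψ hψ
    rw [mapRight_sum_kronecker]
    exact posSemidef_sum _ fun i _ => (ha i).kronecker (hψ _ (hb i))
  · intro H
    refine exists_sum_kronecker_of_mem_convexHull (by_contra fun hh => ?_)
    obtain ⟨G, hstar, hpos, hneg⟩ := exists_entanglement_witness hpsd.1 htr hh
    exact hneg (nonneg_of_mapRight_choiMap G
      (H (choiMap G) fun b hb => posSemidef_choiMap hstar hpos hb))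
end

section
/- Let φ : M_n(ℂ) → M_m(ℂ) be a unital positive linear map of the form φ(x) = Σ_{i=1}^k ω_i(x) b_i, where each ω_i is a state on M_n(ℂ) and each b_i ∈ M_m(ℂ) is positive semidefinite. Let e ∈ M_n(ℂ) be a projection in the definite set of φ (i.e. e = e* = e² and φ(e)² = φ(e)), and put f = 1 − e. Then φ(e) and φ(f) are projections, and for all x ∈ M_n(ℂ): φ(x) = φ(exe) + φ(fxf) = φ(e)φ(x)φ(e) + φ(f)φ(x)φ(f). -/
open Matrix
open scoped ComplexOrder Kronecker

/-- A state on a matrix algebra is a positive unital linear functional. -/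
def IsState {d : Type*} [Fintype d] [DecidableEq d] (σ : Matrix d d ℂ →ₗ[ℂ] ℂ) : Prop :=
  IsPosFun σ ∧ σ 1 = 1

open scoped MatrixOrder in
/-- If `Bᴴ A B = 0` for a positive semidefinite `A`, then `A B = 0`. -/
theorem Matrix.PosSemidef.mul_eq_zero_of_conjTranspose_mul_mul_eq_zero
    {m l : Type*} [Fintype m] [DecidableEq m] [Fintype l] [DecidableEq l]
    {A : Matrix m m ℂ} (hA : A.PosSemidef) {B : Matrix m l ℂ} (h : Bᴴ * A * B = 0) :
    A * B = 0 := by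
  refine ext_of_mulVec_single fun j => ?_
  have key := (hA.dotProduct_mulVec_zero_iff (B *ᵥ Pi.single j 1)).1 (by
    rw [star_mulVec, ← dotProduct_mulVec, mulVec_mulVec, mulVec_mulVec, h]
    simp)
  rw [← mulVec_mulVec, key, zero_mulVec]

/-- If a sum of positive semidefinite matrices is annihilated by `q` from the right, then so is
every summand. -/
theorem Matrix.PosSemidef.mul_eq_zero_of_sum_mul_eq_zero
    {ι m : Type*} [Fintype ι] [Fintype m] [DecidableEq m]
    {A : ι → Matrix m m ℂ} (hA : ∀ i, (A i).PosSemidef) {q : Matrix m m ℂ}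
    (h : (∑ i, A i) * q = 0) (i : ι) : A i * q = 0 := by
  have hpsd : ∀ j, (qᴴ * A j * q).PosSemidef := fun j => (hA j).conjTranspose_mul_mul_same q
  have hsum : ∑ j, (qᴴ * A j * q).trace = 0 := by
    rw [← trace_sum, ← Finset.sum_mul, ← Finset.mul_sum, mul_assoc, h, mul_zero, trace_zero]
  have htr := (Finset.sum_eq_zero_iff_of_nonneg fun j _ => (hpsd j).trace_nonneg).1 hsum i
    (Finset.mem_univ i)
  exact (hA i).mul_eq_zero_of_conjTranspose_mul_mul_eq_zero ((hpsd i).trace_eq_zero_iff.1 htr)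

/-- If `s̄ A + s B + C ≥ 0` for all complex `s`, then `A = B = 0`. -/
theorem Complex.eq_zero_of_forall_conj_mul_add_mul_add_nonneg {A B C : ℂ}
    (h : ∀ s : ℂ, 0 ≤ star s * A + s * B + C) : A = 0 ∧ B = 0 := by
  have hre : ∀ s : ℂ, 0 ≤ (star s * A + s * B + C).re := fun s => (Complex.nonneg_iff.1 (h s)).1
  have him : ∀ s : ℂ, 0 = (star s * A + s * B + C).im := fun s => (Complex.nonneg_iff.1 (h s)).2
  have eq_zero_of_affine : ∀ a c : ℝ, (∀ t : ℝ, 0 ≤ t * a + c) → a = 0 := by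
    intro a c hac
    by_contra ha
    have := hac (-(c + 1) / a)
    rw [div_mul_cancel₀ _ ha] at this
    linarith
  have h₁ : A.re + B.re = 0 := eq_zero_of_affine _ C.re fun t => by
    have := hre t
    simp at this
    linarith
  have h₂ : A.im - B.im = 0 := eq_zero_of_affine _ C.re fun t => by
    have := hre (t * Complex.I)
    simp at this
    linarith
  have h₀ := him 0
  have h₃ := him 1
  have h₄ := him Complex.I
  simp at h₀ h₃ h₄
  constructor <;> apply Complex.ext <;> simp <;> linarith

/-- A positive functional vanishing at a projection `e` vanishes on the left and right ideals
generated by `e`. -/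
theorem IsPosFun.eq_zero_of_projection {d : Type*} [Fintype d]
    {σ : Matrix d d ℂ →ₗ[ℂ] ℂ} (hσ : IsPosFun σ) {e : Matrix d d ℂ} (heherm : eᴴ = e)
    (heidem : e * e = e) (he : σ e = 0) (x : Matrix d d ℂ) :
    σ (e * x) = 0 ∧ σ (x * e) = 0 := by
  have key : ∀ y : Matrix d d ℂ, σ (e * y) = 0 ∧ σ (yᴴ * e) = 0 := fun y =>
    Complex.eq_zero_of_forall_conj_mul_add_mul_add_nonneg (C := σ (yᴴ * y)) fun s => by
      have h := hσ _ (posSemidef_conjTranspose_mul_self (s • e + y))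
      have hexpand : (s • e + y)ᴴ * (s • e + y) =
          (star s * s) • e + star s • (e * y) + s • (yᴴ * e) + yᴴ * y := by
        rw [conjTranspose_add, conjTranspose_smul, heherm, add_mul, mul_add, mul_add,
          smul_mul_smul_comm, heidem, smul_mul_assoc, mul_smul_comm]
        abel
      rw [hexpand] at h
      simpa [he] using h
  exact ⟨(key x).1, by simpa using (key xᴴ).2⟩

/-- A positive functional vanishing at a projection `e` is supported on the corner of `1 - e`. -/
theorem IsPosFun.apply_eq_add_corners {d : Type*} [Fintype d] [DecidableEq d]
    {σ : Matrix d d ℂ →ₗ[ℂ] ℂ} (hσ : IsPosFun σ) {e : Matrix d d ℂ} (heherm : eᴴ = e)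
    (heidem : e * e = e) (he : σ e = 0) (x : Matrix d d ℂ) :
    σ x = σ (e * x * e) + σ ((1 - e) * x * (1 - e)) := by
  have hleft := fun y => (hσ.eq_zero_of_projection heherm heidem he y).1
  have hright := fun y => (hσ.eq_zero_of_projection heherm heidem he y).2
  have hexpand : (1 - e) * x * (1 - e) = x - e * x - x * e + e * x * e := by noncomm_ring
  rw [hexpand, map_add, map_sub, map_sub, hleft, hright, hright]
  ring

/-- A Hermitian matrix annihilated by a Hermitian `p` equals its compression to `1 - p`. -/
theorem Matrix.IsHermitian.eq_add_corners_of_mul_eq_zero {m : Type*} [Fintype m] [DecidableEq m]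
    {b p : Matrix m m ℂ} (hb : b.IsHermitian) (hp : p.IsHermitian) (h : b * p = 0) :
    b = p * b * p + (1 - p) * b * (1 - p) := by
  have h' : p * b = 0 := by rw [← hb.eq, ← hp.eq, ← conjTranspose_mul, h, conjTranspose_zero]
  simp [sub_mul, mul_sub, h, h']

/-- Let `φ(x) = Σ_i ω_i(x) b_i` be a unital positive map with `ω_i`
states and `b_i` positive semidefinite, and let `e` be a projection in the definite set
of `φ` (i.e. `φ(e)² = φ(e)`), with `f = 1 - e`. Then `φ(e)` and `φ(f)` are projections
and `φ(x) = φ(exe) + φ(fxf) = φ(e)φ(x)φ(e) + φ(f)φ(x)φ(f)` for all `x`. -/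
theorem definite_projection_decomposition (n m k : ℕ)
    (φ : Matrix (Fin n) (Fin n) ℂ →ₗ[ℂ] Matrix (Fin m) (Fin m) ℂ)
    (ω : Fin k → (Matrix (Fin n) (Fin n) ℂ →ₗ[ℂ] ℂ))
    (b : Fin k → Matrix (Fin m) (Fin m) ℂ)
    (hω : ∀ i, IsState (ω i)) (hb : ∀ i, (b i).PosSemidef)
    (hform : ∀ x : Matrix (Fin n) (Fin n) ℂ, φ x = ∑ i, ω i x • b i)
    (hunital : φ 1 = 1)
    (hpos : ∀ a : Matrix (Fin n) (Fin n) ℂ, a.PosSemidef → (φ a).PosSemidef)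
    (e : Matrix (Fin n) (Fin n) ℂ) (heherm : eᴴ = e) (heidem : e * e = e)
    (hdef : φ e * φ e = φ e) :
    ((φ e)ᴴ = φ e ∧ φ e * φ e = φ e) ∧
    ((φ (1 - e))ᴴ = φ (1 - e) ∧ φ (1 - e) * φ (1 - e) = φ (1 - e)) ∧
    (∀ x : Matrix (Fin n) (Fin n) ℂ,
      φ x = φ (e * x * e) + φ ((1 - e) * x * (1 - e)) ∧
      φ x = φ e * φ x * φ e + φ (1 - e) * φ x * φ (1 - e)) := by
  have hcompl : ∀ x, φ (1 - x) = 1 - φ x := fun x => by rw [map_sub, hunital]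
  have hfherm : (1 - e)ᴴ = 1 - e := by rw [conjTranspose_sub, conjTranspose_one, heherm]
  have hfidem : (1 - e) * (1 - e) = 1 - e := by simp [sub_mul, mul_sub, heidem]
  have hepsd : e.PosSemidef := by
    simpa [heherm, heidem] using posSemidef_conjTranspose_mul_self e
  have hfpsd : (1 - e).PosSemidef := by
    have := posSemidef_conjTranspose_mul_self (1 - e)
    rwa [hfherm, hfidem] at this
  have hp : (φ e).IsHermitian := (hpos e hepsd).isHermitian
  have hq : (φ (1 - e)).IsHermitian := (hpos _ hfpsd).isHermitian
  have hpq : φ e * φ (1 - e) = 0 := by rw [hcompl, mul_sub, mul_one, hdef, sub_self]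
  have hqp : φ (1 - e) * φ e = 0 := by rw [hcompl, sub_mul, one_mul, hdef, sub_self]
  have annihilate : ∀ g h : Matrix (Fin n) (Fin n) ℂ, g.PosSemidef → φ g * φ h = 0 →
      ∀ i, ω i g = 0 ∨ b i * φ h = 0 := fun g h hg hgh i => by
    rw [hform g] at hgh
    have := PosSemidef.mul_eq_zero_of_sum_mul_eq_zero
      (fun j => (hb j).smul ((hω j).1 g hg)) hgh i
    rwa [smul_mul_assoc, smul_eq_zero] at this
  have trichotomy : ∀ i, b i = 0 ∨ (ω i e = 0 ∧ b i * φ e = 0) ∨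
      (ω i (1 - e) = 0 ∧ b i * φ (1 - e) = 0) := fun i => by
    have hone : ω i e + ω i (1 - e) = 1 := by rw [← map_add, add_sub_cancel, (hω i).2]
    rcases annihilate e _ hepsd hpq i with h₁ | h₁ <;>
      rcases annihilate _ e hfpsd hqp i with h₂ | h₂
    · simp [h₁, h₂] at hone
    · exact .inr (.inl ⟨h₁, h₂⟩)
    · exact .inr (.inr ⟨h₂, h₁⟩)
    · rw [hcompl, mul_sub, mul_one, h₂, sub_zero] at h₁
      exact .inl h₁
  have hcorner : ∀ i, b i = φ e * b i * φ e + φ (1 - e) * b i * φ (1 - e) := fun i => by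
    rcases trichotomy i with h | ⟨-, h⟩ | ⟨-, h⟩
    · simp [h]
    · simpa only [hcompl] using (hb i).isHermitian.eq_add_corners_of_mul_eq_zero hp h
    · have := (hb i).isHermitian.eq_add_corners_of_mul_eq_zero hq h
      rw [← hcompl, sub_sub_cancel] at this
      rwa [add_comm] at this
  refine ⟨⟨hp.eq, hdef⟩, ⟨hq.eq, ?_⟩, fun x => ⟨?_, ?_⟩⟩
  · simp only [hcompl, sub_mul, mul_sub, one_mul, mul_one, hdef, sub_self, sub_zero]
  · rw [hform x, hform (e * x * e), hform ((1 - e) * x * (1 - e)), ← Finset.sum_add_distrib]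
    refine Finset.sum_congr rfl fun i _ => ?_
    rw [← add_smul]
    rcases trichotomy i with h | ⟨h, -⟩ | ⟨h, -⟩
    · simp [h]
    · rw [← (hω i).1.apply_eq_add_corners heherm heidem h x]
    · have := (hω i).1.apply_eq_add_corners hfherm hfidem h x
      rw [sub_sub_cancel, add_comm] at this
      rw [← this]
  · have hcompress : ∀ r, r * φ x * r = ∑ i, ω i x • (r * b i * r) := fun r => by
      simp only [hform x, Finset.mul_sum, Finset.sum_mul, mul_smul_comm, smul_mul_assoc]
    rw [hcompress, hcompress, ← Finset.sum_add_distrib]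
    simp only [← smul_add, ← hcorner]
    exact hform x
end

section
/- Let φ : M_n(ℂ) → M_m(ℂ) be a unital positive linear map of the form φ(x) = Σ_{i=1}^k ω_i(x) b_i with ω_i states on M_n(ℂ) and b_i ∈ M_m(ℂ) positive semidefinite and nonzero. Let e ∈ M_n(ℂ) be a projection with φ(e)² = φ(e), and f = 1 − e. Then for each i, either ω_i(e) = 0 or ω_i(f) = 0, and consequently ω_i(exf) = ω_i(fxe) = 0 for all x ∈ M_n(ℂ). -/
open Matrix
open scoped ComplexOrder Kronecker

open scoped MatrixOrder in
theorem Matrix.PosSemidef.trace_mul_nonneg_s12 {d : Type*} [Fintype d]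
    {a b : Matrix d d ℂ} (ha : a.PosSemidef) (hb : b.PosSemidef) : 0 ≤ (a * b).trace := by
  classical
  obtain ⟨c, rfl⟩ := CStarAlgebra.nonneg_iff_eq_star_mul_self.mp ha.nonneg
  rw [Matrix.star_eq_conjTranspose, Matrix.mul_assoc, Matrix.trace_mul_comm]
  exact (hb.mul_mul_conjTranspose_same c).trace_nonneg

/-- If an affine function of a real variable is nonnegative in the complex order, its slope
vanishes. -/
theorem eq_zero_of_forall_add_ofReal_mul_nonneg {r s : ℂ} (h : ∀ t : ℝ, 0 ≤ r + t * s) :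
    s = 0 := by
  simp only [Complex.le_def, Complex.zero_re, Complex.zero_im, Complex.add_re, Complex.add_im,
    Complex.re_ofReal_mul, Complex.im_ofReal_mul] at h
  apply Complex.ext
  · by_contra hs
    have h1 := (h (-(r.re + 1) / s.re)).1
    have hs' : s.re ≠ 0 := hs
    rw [div_mul_cancel₀ _ hs'] at h1
    linarith
  · have h0 := (h 0).2
    have h1 := (h 1).2
    simp only [Complex.zero_im]
    linarith

/-- If a positive functional vanishes on `aᴴ * a`, it vanishes on every `aᴴ * y` and `y * a`. -/
theorem IsPosFun.apply_mul_eq_zero {d : Type*} [Fintype d] {σ : Matrix d d ℂ →ₗ[ℂ] ℂ}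
    (hσ : IsPosFun σ) {a : Matrix d d ℂ} (ha : σ (aᴴ * a) = 0) (y : Matrix d d ℂ) :
    σ (aᴴ * y) = 0 ∧ σ (y * a) = 0 := by
  have sum_eq_zero (z : Matrix d d ℂ) : σ (zᴴ * a) + σ (aᴴ * z) = 0 := by
    refine eq_zero_of_forall_add_ofReal_mul_nonneg (r := σ (zᴴ * z)) fun t ↦ ?_
    have h := hσ _ (Matrix.posSemidef_conjTranspose_mul_self (z + (t : ℂ) • a))
    simp only [conjTranspose_add, conjTranspose_smul, Matrix.add_mul, Matrix.mul_add,
      Matrix.smul_mul, Matrix.mul_smul, map_add, map_smul, ha, smul_eq_mul, mul_zero,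
      add_zero, Complex.star_def, Complex.conj_ofReal] at h
    linear_combination h
  have both (z : Matrix d d ℂ) : σ (zᴴ * a) = 0 ∧ σ (aᴴ * z) = 0 := by
    have h1 := sum_eq_zero z
    have h2 := sum_eq_zero (Complex.I • z)
    simp only [conjTranspose_smul, Matrix.smul_mul, Matrix.mul_smul, map_smul, smul_eq_mul,
      Complex.star_def, Complex.conj_I] at h2
    constructor
    · linear_combination (1 / 2) * h1 + (Complex.I / 2) * h2 +
        (σ (zᴴ * a) - σ (aᴴ * z)) / 2 * Complex.I_mul_I
    · linear_combination (1 / 2) * h1 - (Complex.I / 2) * h2 -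
        (σ (zᴴ * a) - σ (aᴴ * z)) / 2 * Complex.I_mul_I
  exact ⟨(both y).2, by simpa using (both yᴴ).1⟩

/-- Let `φ(x) = Σ_i ω_i(x) b_i` be a unital positive map with `ω_i`
states and `b_i` nonzero positive semidefinite, and let `e` be a projection with
`φ(e)² = φ(e)`, `f = 1 - e`. Then for each `i` either `ω_i(e) = 0` or `ω_i(f) = 0`, and
consequently `ω_i(exf) = ω_i(fxe) = 0` for all `x`. -/
theorem state_kernel_dichotomy (n m k : ℕ)
    (φ : Matrix (Fin n) (Fin n) ℂ →ₗ[ℂ] Matrix (Fin m) (Fin m) ℂ)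
    (ω : Fin k → (Matrix (Fin n) (Fin n) ℂ →ₗ[ℂ] ℂ))
    (b : Fin k → Matrix (Fin m) (Fin m) ℂ)
    (hω : ∀ i, IsState (ω i)) (hb : ∀ i, (b i).PosSemidef) (hb0 : ∀ i, b i ≠ 0)
    (hform : ∀ x : Matrix (Fin n) (Fin n) ℂ, φ x = ∑ i, ω i x • b i)
    (hunital : φ 1 = 1)
    (hpos : ∀ a : Matrix (Fin n) (Fin n) ℂ, a.PosSemidef → (φ a).PosSemidef)
    (e : Matrix (Fin n) (Fin n) ℂ) (heherm : eᴴ = e) (heidem : e * e = e)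
    (hdef : φ e * φ e = φ e) :
    ∀ i, (ω i e = 0 ∨ ω i (1 - e) = 0) ∧
      ∀ x : Matrix (Fin n) (Fin n) ℂ,
        ω i (e * x * (1 - e)) = 0 ∧ ω i ((1 - e) * x * e) = 0 := by
  have he : e.PosSemidef := by
    simpa [heherm, heidem] using Matrix.posSemidef_conjTranspose_mul_self e
  have hfherm : (1 - e)ᴴ = 1 - e := by simp [heherm]
  have hfidem : (1 - e) * (1 - e) = 1 - e := by
    simp [Matrix.mul_sub, Matrix.sub_mul, heidem]
  have hf : (1 - e).PosSemidef := by
    have h := Matrix.posSemidef_conjTranspose_mul_self (1 - e)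
    rwa [hfherm, hfidem] at h
  have htrace : ∑ i, ∑ j, ω i e * ω j (1 - e) * (b i * b j).trace = 0 := by
    have h : (φ e * φ (1 - e)).trace = 0 := by
      simp [map_sub, hunital, Matrix.mul_sub, hdef]
    rw [← h, hform, hform, Matrix.sum_mul, Matrix.trace_sum]
    refine Finset.sum_congr rfl fun i _ ↦ ?_
    rw [Matrix.mul_sum, Matrix.trace_sum]
    refine Finset.sum_congr rfl fun j _ ↦ ?_
    simp only [Matrix.smul_mul, Matrix.mul_smul, Matrix.trace_smul, smul_eq_mul]
    ring
  have hterm (i j : Fin k) : 0 ≤ ω i e * ω j (1 - e) * (b i * b j).trace :=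
    mul_nonneg (mul_nonneg ((hω i).1 e he) ((hω j).1 _ hf)) ((hb i).trace_mul_nonneg_s12 (hb j))
  intro i
  have hdich : ω i e = 0 ∨ ω i (1 - e) = 0 := by
    have hrow := (Finset.sum_eq_zero_iff_of_nonneg fun i _ ↦
      Finset.sum_nonneg fun j _ ↦ hterm i j).mp htrace i (Finset.mem_univ i)
    have hdiag := (Finset.sum_eq_zero_iff_of_nonneg fun j _ ↦ hterm i j).mp hrow i
      (Finset.mem_univ i)
    have hbi : (b i * b i).trace ≠ 0 := fun h ↦ hb0 i <| by
      rw [← Matrix.trace_conjTranspose_mul_self_eq_zero_iff, (hb i).isHermitian.eq, h]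
    exact mul_eq_zero.mp ((mul_eq_zero.mp hdiag).resolve_right hbi)
  refine ⟨hdich, fun x ↦ ?_⟩
  rcases hdich with h | h
  · have hker := (hω i).1.apply_mul_eq_zero (a := e) (by rwa [heherm, heidem])
    rw [heherm] at hker
    exact ⟨by simpa only [Matrix.mul_assoc] using (hker (x * (1 - e))).1,
      (hker ((1 - e) * x)).2⟩
  · have hker := (hω i).1.apply_mul_eq_zero (a := 1 - e) (by rwa [hfherm, hfidem])
    rw [hfherm] at hker
    exact ⟨(hker (e * x)).2,
      by simpa only [Matrix.mul_assoc] using (hker (x * e)).1⟩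
end

section
/- Let φ : M_n(ℂ) → M_m(ℂ) be a unital positive linear map of the form φ(x) = Σ_{i=1}^k ω_i(x) b_i with ω_i states on M_n(ℂ) and b_i ∈ M_m(ℂ) positive semidefinite. Then for every projection e ∈ M_n(ℂ) with φ(e)² = φ(e), the matrix φ(e) commutes with φ(x) for every x ∈ M_n(ℂ); in particular φ maps the projections in its definite set into the commutant of the range of φ. -/
open Matrix
open scoped ComplexOrder Kronecker

open scoped MatrixOrder in
theorem Matrix.PosSemidef.mul_eq_zero_of_conj_eq_zero {d : Type*} [Fintype d] [DecidableEq d]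
    {b q : Matrix d d ℂ} (hb : b.PosSemidef) (h : qᴴ * b * q = 0) : b * q = 0 := by
  obtain ⟨B, rfl⟩ := CStarAlgebra.nonneg_iff_eq_star_mul_self.mp hb.nonneg
  rw [Matrix.star_eq_conjTranspose] at h ⊢
  have h_zero : B * q = 0 := by
    rw [← Matrix.conjTranspose_mul_self_eq_zero, Matrix.conjTranspose_mul]
    simpa only [Matrix.mul_assoc] using h
  rw [Matrix.mul_assoc, h_zero, Matrix.mul_zero]

open scoped MatrixOrder in
/-- If a nonnegative combination of positive semidefinite matrices is compressed to zero by `q`,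
then `q` is annihilated by each matrix that occurs with a nonzero coefficient. -/
theorem Matrix.PosSemidef.mul_eq_zero_of_sum_conj_eq_zero {ι d : Type*} [Fintype ι] [Fintype d]
    [DecidableEq d] {b : ι → Matrix d d ℂ} {q : Matrix d d ℂ} {c : ι → ℂ}
    (hb : ∀ i, (b i).PosSemidef) (hc : ∀ i, 0 ≤ c i)
    (h : qᴴ * (∑ i, c i • b i) * q = 0) {i : ι} (hi : c i ≠ 0) : b i * q = 0 := by
  rw [Finset.mul_sum, Finset.sum_mul, Finset.sum_eq_zero_iff_of_nonneg fun j _ =>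
    (((hb j).smul (hc j)).conjTranspose_mul_mul_same q).nonneg] at h
  refine (hb i).mul_eq_zero_of_conj_eq_zero ?_
  simpa [hi] using h i (Finset.mem_univ i)

/-- Let `φ(x) = Σ_i ω_i(x) b_i` be a unital positive map with `ω_i`
states and `b_i` positive semidefinite. Then for every projection `e` with
`φ(e)² = φ(e)`, the matrix `φ(e)` commutes with `φ(x)` for every `x`; in particular `φ`
maps the projections in its definite set into the commutant of the range of `φ`. -/
theorem definite_projection_image_commutes (n m k : ℕ)
    (φ : Matrix (Fin n) (Fin n) ℂ →ₗ[ℂ] Matrix (Fin m) (Fin m) ℂ)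
    (ω : Fin k → (Matrix (Fin n) (Fin n) ℂ →ₗ[ℂ] ℂ))
    (b : Fin k → Matrix (Fin m) (Fin m) ℂ)
    (hω : ∀ i, IsState (ω i)) (hb : ∀ i, (b i).PosSemidef)
    (hform : ∀ x : Matrix (Fin n) (Fin n) ℂ, φ x = ∑ i, ω i x • b i)
    (hunital : φ 1 = 1)
    (hpos : ∀ a : Matrix (Fin n) (Fin n) ℂ, a.PosSemidef → (φ a).PosSemidef) :
    ∀ e : Matrix (Fin n) (Fin n) ℂ, eᴴ = e → e * e = e → φ e * φ e = φ e →
      ∀ x : Matrix (Fin n) (Fin n) ℂ, φ e * φ x = φ x * φ e := by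
  intro e he hee hφe x
  have h_psd_e : e.PosSemidef := by
    simpa [he, hee] using Matrix.posSemidef_conjTranspose_mul_self e
  have h_psd_compl : (1 - e).PosSemidef := by
    have h := Matrix.posSemidef_conjTranspose_mul_self (1 - e)
    simpa [he, hee, sub_mul, mul_sub] using h
  have h_herm : (φ e)ᴴ = φ e := (hpos e h_psd_e).isHermitian
  have h_commute : ∀ i, Commute (φ e) (b i) := by
    intro i
    have h_herm_b : (b i)ᴴ = b i := (hb i).isHermitian
    by_cases hi : ω i e = 0
    · have h_zero : b i * φ e = 0 := by
        refine Matrix.PosSemidef.mul_eq_zero_of_sum_conj_eq_zero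
          (c := fun j => ω j (1 - e)) hb (fun j => (hω j).1 _ h_psd_compl) ?_ ?_
        · rw [← hform, map_sub, hunital, h_herm, mul_sub, mul_one, hφe, sub_self, zero_mul]
        · simp [hi, (hω i).2]
      have h_zero_adj : φ e * b i = 0 := by
        simpa [h_herm, h_herm_b] using congrArg Matrix.conjTranspose h_zero
      exact h_zero_adj.trans h_zero.symm
    · have h_zero : b i * (1 - φ e) = 0 := by
        refine Matrix.PosSemidef.mul_eq_zero_of_sum_conj_eq_zero
          (c := fun j => ω j e) hb (fun j => (hω j).1 _ h_psd_e) ?_ hi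
        rw [← hform, mul_assoc, mul_sub, mul_one, hφe, sub_self, mul_zero]
      have h_zero_adj : (1 - φ e) * b i = 0 := by
        simpa [h_herm, h_herm_b] using congrArg Matrix.conjTranspose h_zero
      rw [mul_sub, mul_one, sub_eq_zero] at h_zero
      rw [sub_mul, one_mul, sub_eq_zero] at h_zero_adj
      exact h_zero_adj.symm.trans h_zero
  rw [hform x]
  exact Commute.sum_right _ _ _ fun i _ => (h_commute i).smul_right _
end

section
/- Let φ : M_n(ℂ) → M_m(ℂ) be a unital positive linear map of the form φ(x) = Σ_{i=1}^k ω_i(x) b_i with ω_i states on M_n(ℂ) and b_i ∈ M_m(ℂ) positive semidefinite, and suppose φ is faithful (φ(x*x) = 0 implies x = 0). Then any two elements of the definite set D_φ commute, i.e. D_φ generates an abelian algebra. -/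
open Matrix
open scoped ComplexOrder Kronecker

theorem Complex.eq_zero_of_forall_nonneg_add_mul {A w : ℂ} (h : ∀ t : ℝ, 0 ≤ A + t * w) :
    w = 0 := by
  have hre : ∀ t : ℝ, 0 ≤ A.re + t * w.re := fun t => by
    simpa using (Complex.le_def.1 (h t)).1
  have him : ∀ t : ℝ, 0 = A.im + t * w.im := fun t => by
    simpa using (Complex.le_def.1 (h t)).2
  apply Complex.ext
  · by_contra hw
    have hw' : w.re ≠ 0 := hw
    have := hre (-(A.re + 1) / w.re)
    rw [div_mul_cancel₀ _ hw'] at this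
    linarith
  · have h0 := him 0
    have h1 := him 1
    simp only [Complex.zero_im]
    linarith

section PositiveFunctional

variable {d : Type*} [Fintype d] {σ : Matrix d d ℂ →ₗ[ℂ] ℂ}

theorem IsPosFun.conjTranspose_mul_self_nonneg (hσ : IsPosFun σ) (x : Matrix d d ℂ) :
    0 ≤ σ (xᴴ * x) :=
  hσ _ (posSemidef_conjTranspose_mul_self x)

/-- If `σ (xᴴ * x) = 0`, then `x` lies in the left kernel of the sesquilinear form of `σ`. -/
theorem IsPosFun.map_conjTranspose_mul_eq_zero (hσ : IsPosFun σ) {x : Matrix d d ℂ}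
    (hx : σ (xᴴ * x) = 0) (y : Matrix d d ℂ) : σ (xᴴ * y) = 0 := by
  have key : ∀ s : ℂ, 0 ≤ σ (yᴴ * y) + (s * σ (yᴴ * x) + star s * σ (xᴴ * y)) := fun s => by
    have h := hσ.conjTranspose_mul_self_nonneg (y + s • x)
    have e : (y + s • x)ᴴ * (y + s • x) =
        yᴴ * y + (s • (yᴴ * x) + star s • (xᴴ * y)) + (s * star s) • (xᴴ * x) := by
      simp only [conjTranspose_add, conjTranspose_smul, add_mul, mul_add, smul_mul_assoc,
        mul_smul_comm, smul_add, mul_smul]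
      abel
    rw [e] at h
    simpa only [map_add, map_smul, smul_eq_mul, hx, mul_zero, add_zero] using h
  have h1 : σ (yᴴ * x) + σ (xᴴ * y) = 0 :=
    Complex.eq_zero_of_forall_nonneg_add_mul (A := σ (yᴴ * y)) fun t => by
      simpa [mul_add] using key t
  have h2 : Complex.I * (σ (yᴴ * x) - σ (xᴴ * y)) = 0 :=
    Complex.eq_zero_of_forall_nonneg_add_mul (A := σ (yᴴ * y)) fun t => by
      have := key (t * Complex.I)
      convert this using 2
      simp
      ring
  have h3 := (mul_eq_zero.1 h2).resolve_left Complex.I_ne_zero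
  linear_combination (h1 - h3) / 2

variable [DecidableEq d]

theorem IsState.star_map (hσ : IsState σ) {a : Matrix d d ℂ} (ha : aᴴ = a) :
    star (σ a) = σ a := by
  have h1 := hσ.1.conjTranspose_mul_self_nonneg (a + 1)
  have h2 := hσ.1.conjTranspose_mul_self_nonneg a
  have e : (a + 1)ᴴ * (a + 1) = a * a + (a + a) + 1 := by
    rw [conjTranspose_add, conjTranspose_one, ha]
    noncomm_ring
  rw [e, map_add, map_add, map_add, hσ.2] at h1
  rw [ha] at h2
  have i1 := (Complex.le_def.1 h1).2
  have i2 := (Complex.le_def.1 h2).2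
  simp only [Complex.add_im, Complex.zero_im, Complex.one_im] at i1 i2
  exact Complex.conj_eq_iff_im.2 (by linarith)

theorem IsState.conjTranspose_sub_smul_one (hσ : IsState σ) {a : Matrix d d ℂ} (ha : aᴴ = a) :
    (a - σ a • (1 : Matrix d d ℂ))ᴴ = a - σ a • (1 : Matrix d d ℂ) := by
  rw [conjTranspose_sub, conjTranspose_smul, conjTranspose_one, ha, hσ.star_map ha]

theorem IsState.map_sub_smul_one_mul_self (hσ : IsState σ) (a : Matrix d d ℂ) :
    σ ((a - σ a • (1 : Matrix d d ℂ)) * (a - σ a • (1 : Matrix d d ℂ))) =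
      σ (a * a) - σ a * σ a := by
  simp only [sub_mul, mul_sub, smul_mul_assoc, mul_smul_comm, one_mul, mul_one, map_sub,
    map_smul, smul_eq_mul, hσ.2]
  ring

theorem IsState.variance_nonneg (hσ : IsState σ) {a : Matrix d d ℂ} (ha : aᴴ = a) :
    0 ≤ σ (a * a) - σ a * σ a := by
  have h := hσ.1.conjTranspose_mul_self_nonneg (a - σ a • (1 : Matrix d d ℂ))
  rwa [hσ.conjTranspose_sub_smul_one ha, hσ.map_sub_smul_one_mul_self] at h

/-- A state is multiplicative at a Hermitian matrix on which it has no variance. -/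
theorem IsState.map_mul_of_variance_eq_zero (hσ : IsState σ) {a : Matrix d d ℂ} (ha : aᴴ = a)
    (hv : σ (a * a) - σ a * σ a = 0) (y : Matrix d d ℂ) : σ (a * y) = σ a * σ y := by
  have hc := hσ.conjTranspose_sub_smul_one ha
  have h := hσ.1.map_conjTranspose_mul_eq_zero
    (x := a - σ a • (1 : Matrix d d ℂ)) (by rw [hc, hσ.map_sub_smul_one_mul_self, hv]) y
  rw [hc, sub_mul, smul_mul_assoc, one_mul, map_sub, map_smul, smul_eq_mul] at h
  exact sub_eq_zero.1 h

end PositiveFunctional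

/-- If `a` is in the definite set of `x ↦ ∑ i, ω i x • b i`, then every state with a nonzero
coefficient has no variance at `a`. -/
theorem variance_eq_zero_or_coeff_eq_zero {d e ι : Type*} [Fintype d] [DecidableEq d]
    [Fintype e] [DecidableEq e] [Fintype ι] {ω : ι → (Matrix d d ℂ →ₗ[ℂ] ℂ)}
    {b : ι → Matrix e e ℂ} (hω : ∀ i, IsState (ω i)) (hb : ∀ i, (b i).PosSemidef)
    (hsum : ∑ i, b i = 1) {a : Matrix d d ℂ} (ha : aᴴ = a)
    (hdef : ∑ i, ω i (a * a) • b i = (∑ i, ω i a • b i) * ∑ i, ω i a • b i) (i : ι) :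
    ω i (a * a) - ω i a * ω i a = 0 ∨ b i = 0 := by
  set h : Matrix e e ℂ := ∑ i, ω i a • b i with hh
  have h_herm : hᴴ = h := by
    rw [hh, conjTranspose_sum]
    refine Finset.sum_congr rfl fun j _ => ?_
    rw [conjTranspose_smul, (hω j).star_map ha, (hb j).1.eq]
  let T : ι → Matrix e e ℂ := fun j =>
    (ω j a • (1 : Matrix e e ℂ) - h)ᴴ * b j * (ω j a • (1 : Matrix e e ℂ) - h)
  have hT : ∀ j, (T j).PosSemidef := fun j => (hb j).conjTranspose_mul_mul_same _
  let v : ι → ℂ := fun j => ω j (a * a) - ω j a * ω j a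
  have hv : ∀ j, (v j • b j).PosSemidef := fun j => (hb j).smul ((hω j).variance_nonneg ha)
  have hterm : ∀ j, T j + v j • b j =
      ω j (a * a) • b j - (ω j a • b j) * h - h * (ω j a • b j) + h * b j * h := fun j => by
    have hc : (ω j a • (1 : Matrix e e ℂ) - h)ᴴ = ω j a • (1 : Matrix e e ℂ) - h := by
      rw [conjTranspose_sub, conjTranspose_smul, conjTranspose_one, h_herm, (hω j).star_map ha]
    simp only [T, v, hc, sub_mul, mul_sub, smul_mul_assoc, mul_smul_comm, one_mul, mul_one,
      sub_smul, smul_sub, mul_smul]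
    abel
  have hzero : ∑ j, (T j + v j • b j) = 0 := by
    simp only [hterm, Finset.sum_add_distrib, Finset.sum_sub_distrib, ← Finset.sum_mul,
      ← Finset.mul_sum]
    rw [hsum, hdef, ← hh, mul_one]
    abel
  have htr : ∑ j, (T j + v j • b j).trace = 0 := by
    rw [← trace_sum, hzero, trace_zero]
  have hi := (Finset.sum_eq_zero_iff_of_nonneg
    fun j _ => ((hT j).add (hv j)).trace_nonneg).1 htr i (Finset.mem_univ i)
  rw [trace_add] at hi
  have hvi := ((add_eq_zero_iff_of_nonneg (hT i).trace_nonneg (hv i).trace_nonneg).1 hi).2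
  exact smul_eq_zero.1 ((hv i).trace_eq_zero_iff.1 hvi)

/-- Let `φ(x) = Σ_i ω_i(x) b_i` be a unital positive faithful map with
`ω_i` states and `b_i` positive semidefinite. Then any two elements of the definite set
`D_φ = {a : aᴴ = a, φ(a²) = φ(a)²}` commute, i.e. `D_φ` generates an abelian algebra. -/
theorem definite_set_abelian_of_faithful (n m k : ℕ)
    (φ : Matrix (Fin n) (Fin n) ℂ →ₗ[ℂ] Matrix (Fin m) (Fin m) ℂ)
    (ω : Fin k → (Matrix (Fin n) (Fin n) ℂ →ₗ[ℂ] ℂ))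
    (b : Fin k → Matrix (Fin m) (Fin m) ℂ)
    (hω : ∀ i, IsState (ω i)) (hb : ∀ i, (b i).PosSemidef)
    (hform : ∀ x : Matrix (Fin n) (Fin n) ℂ, φ x = ∑ i, ω i x • b i)
    (hunital : φ 1 = 1)
    (hpos : ∀ a : Matrix (Fin n) (Fin n) ℂ, a.PosSemidef → (φ a).PosSemidef)
    (hfaithful : ∀ x : Matrix (Fin n) (Fin n) ℂ, φ (xᴴ * x) = 0 → x = 0) :
    ∀ a c : Matrix (Fin n) (Fin n) ℂ,
      aᴴ = a → φ (a * a) = φ a * φ a →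
      cᴴ = c → φ (c * c) = φ c * φ c →
      a * c = c * a := by
  intro a c ha hda hc hdc
  have hsum : ∑ i, b i = 1 := by
    rw [← hunital, hform]
    exact Finset.sum_congr rfl fun i _ => by rw [(hω i).2, one_smul]
  have mult : ∀ {a : Matrix (Fin n) (Fin n) ℂ}, aᴴ = a → φ (a * a) = φ a * φ a →
      ∀ i, b i ≠ 0 → ∀ y, ω i (a * y) = ω i a * ω i y := fun ha hda i hi =>
    (hω i).map_mul_of_variance_eq_zero ha
      ((variance_eq_zero_or_coeff_eq_zero hω hb hsum ha
        (by simpa only [hform] using hda) i).resolve_right hi)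
  have hcomm : (a * c - c * a)ᴴ = 0 := by
    apply hfaithful
    rw [conjTranspose_conjTranspose, hform]
    refine Finset.sum_eq_zero fun i _ => ?_
    by_cases hi : b i = 0
    · rw [hi, smul_zero]
    · rw [sub_mul, map_sub, mul_assoc, mul_assoc, mult ha hda i hi, mult hc hdc i hi,
        mult hc hdc i hi, mult ha hda i hi, mul_left_comm, sub_self, zero_smul]
  exact sub_eq_zero.1 (conjTranspose_eq_zero.1 hcomm)
end

section
/- Let A be a unital *-subalgebra of M_n(ℂ) and let φ : M_n(ℂ) → M_n(ℂ) be a conditional expectation onto A, i.e. a positive linear map with range A satisfying φ(a) = a for all a ∈ A and φ(a x b) = a φ(x) b for all a, b ∈ A and x ∈ M_n(ℂ). Then the associated functional φ̃ defined by φ̃(a ⊗ b) = Tr(φ(a) bᵀ) is a separable positive linear functional on M_n(ℂ) ⊗ M_n(ℂ) if and only if A is commutative. -/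
open Matrix
open scoped ComplexOrder Kronecker

/-- The density matrix of a positive functional on a matrix algebra is positive semidefinite. -/
theorem IsPosFun.posSemidef_of_single {d : Type*} [Fintype d] [DecidableEq d]
    {ω : Matrix d d ℂ →ₗ[ℂ] ℂ} (hω : IsPosFun ω) :
    (of fun i j => ω (single i j 1)).PosSemidef := by
  have key (x : d → ℂ) :
      star x ⬝ᵥ ((of fun i j => ω (single i j 1)) *ᵥ x) = ω (vecMulVec (star x) x) := by
    conv_rhs => rw [matrix_eq_sum_single (vecMulVec (star x) x)]
    simp only [map_sum, dotProduct, mulVec, of_apply, Finset.mul_sum]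
    refine Finset.sum_congr rfl fun i _ => Finset.sum_congr rfl fun j _ => ?_
    have h : single i j (vecMulVec (star x) x i j)
        = vecMulVec (star x) x i j • single i j (1 : ℂ) := by
      simp [smul_single]
    rw [h, map_smul, vecMulVec_apply, smul_eq_mul]
    ring
  have hnn (x : d → ℂ) : 0 ≤ star x ⬝ᵥ ((of fun i j => ω (single i j 1)) *ᵥ x) := by
    rw [key]
    apply hω
    simpa using posSemidef_vecMulVec_self_star (star x)
  rw [← isPositive_toEuclideanLin_iff, LinearMap.isPositive_iff_complex]
  intro x
  have h := hnn x.ofLp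
  have e : inner ℂ (toEuclideanLin (of fun i j => ω (single i j 1)) x) x
      = star (star x.ofLp ⬝ᵥ ((of fun i j => ω (single i j 1)) *ᵥ x.ofLp)) := by
    rw [EuclideanSpace.inner_eq_star_dotProduct, ← star_dotProduct_star, star_star,
      dotProduct_comm]
    rfl
  rw [e, (IsSelfAdjoint.of_nonneg h).star_eq]
  exact ⟨Complex.conj_eq_iff_re.1 (IsSelfAdjoint.of_nonneg h).star_eq, (Complex.le_def.1 h).1⟩

/-- Positive functionals are hermitian. -/
theorem IsPosFun.map_conjTranspose {d : Type*} [Fintype d] [DecidableEq d]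
    {σ : Matrix d d ℂ →ₗ[ℂ] ℂ} (hσ : IsPosFun σ) (a : Matrix d d ℂ) :
    σ aᴴ = star (σ a) := by
  have hexp (b : Matrix d d ℂ) : σ b = ∑ i, ∑ j, b i j * σ (single i j 1) := by
    conv_lhs => rw [matrix_eq_sum_single b]
    simp only [map_sum]
    refine Finset.sum_congr rfl fun i _ => Finset.sum_congr rfl fun j _ => ?_
    rw [← smul_eq_mul, ← map_smul, smul_single, smul_eq_mul, mul_one]
  have hherm (i j : d) : star (σ (single i j 1)) = σ (single j i 1) :=
    hσ.posSemidef_of_single.isHermitian.apply j i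
  rw [hexp aᴴ, hexp a, Finset.sum_comm]
  simp only [star_sum, star_mul', hherm, conjTranspose_apply]

/-- Expansion of a positive functional on a square `(a - c)ᴴ (a - c)`. -/
theorem IsPosFun.sq_expansion_nonneg {d : Type*} [Fintype d] [DecidableEq d]
    {σ : Matrix d d ℂ →ₗ[ℂ] ℂ} (hσ : IsPosFun σ) (a : Matrix d d ℂ) (c : ℂ) :
    0 ≤ σ (aᴴ * a) - c * star (σ a) - star c * σ a + star c * c * σ 1 := by
  have h := hσ _ (posSemidef_conjTranspose_mul_self (a - c • (1 : Matrix d d ℂ)))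
  have e : (a - c • (1 : Matrix d d ℂ))ᴴ * (a - c • (1 : Matrix d d ℂ))
      = aᴴ * a - c • aᴴ - star c • a + (star c * c) • (1 : Matrix d d ℂ) := by
    simp only [conjTranspose_sub, conjTranspose_smul, conjTranspose_one, sub_mul, mul_sub,
      smul_mul_assoc, mul_smul_comm, one_mul, mul_one]
    rw [mul_comm (star c), mul_smul, smul_sub]
    abel
  rw [e] at h
  simpa [hσ.map_conjTranspose] using h

/-- A positive functional vanishing at `1` is zero. -/
theorem IsPosFun.apply_eq_zero {d : Type*} [Fintype d] [DecidableEq d]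
    {σ : Matrix d d ℂ →ₗ[ℂ] ℂ} (hσ : IsPosFun σ) (h1 : σ 1 = 0) (a : Matrix d d ℂ) :
    σ a = 0 := by
  have h0 : 0 ≤ σ (aᴴ * a) := hσ _ (posSemidef_conjTranspose_mul_self a)
  have key (t : ℝ) : 0 ≤ (σ (aᴴ * a)).re - 2 * t * Complex.normSq (σ a) := by
    have h := (Complex.le_def.1 (hσ.sq_expansion_nonneg a (t * σ a))).1
    simp [h1, Complex.normSq_apply] at h ⊢
    linarith
  by_contra hne
  have hpos : 0 < Complex.normSq (σ a) := Complex.normSq_pos.2 hne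
  have h := key (((σ (aᴴ * a)).re + 1) / (2 * Complex.normSq (σ a)))
  field_simp at h
  linarith

/-- The Cauchy-Schwarz inequality for a positive functional. -/
theorem IsPosFun.star_mul_self_div_le {d : Type*} [Fintype d] [DecidableEq d]
    {σ : Matrix d d ℂ →ₗ[ℂ] ℂ} (hσ : IsPosFun σ) (a : Matrix d d ℂ) :
    star (σ a) * σ a / σ 1 ≤ σ (aᴴ * a) := by
  by_cases h1 : σ 1 = 0
  · simp [h1, hσ.apply_eq_zero]
  have hs : star (σ 1) = σ 1 := by simpa using (hσ.map_conjTranspose 1).symm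
  have h := hσ.sq_expansion_nonneg a (σ a / σ 1)
  rw [← sub_nonneg]
  convert h using 1
  rw [star_div₀, hs]
  field_simp
  ring

/-- If the identity on a star-closed set of matrices factors through positive functionals and
positive semidefinite matrices, then the matrices of that set satisfy `a aᴴ ≤ aᴴ a`. -/
theorem posSemidef_conjTranspose_mul_self_sub {d : Type*} [Fintype d] [DecidableEq d] {k : ℕ}
    {σ : Fin k → Matrix d d ℂ →ₗ[ℂ] ℂ} {w : Fin k → Matrix d d ℂ}
    (hσ : ∀ i, IsPosFun (σ i)) (hw : ∀ i, (w i).PosSemidef) {a : Matrix d d ℂ}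
    (h1 : ∑ i, σ i 1 • w i = 1) (ha : ∑ i, σ i a • w i = a)
    (haa : ∑ i, σ i (aᴴ * a) • w i = aᴴ * a) :
    (aᴴ * a - a * aᴴ).PosSemidef := by
  have hs (i) : star (σ i 1) = σ i 1 := by simpa using ((hσ i).map_conjTranspose 1).symm
  have ha' : ∑ i, star (σ i a) • w i = aᴴ := by
    conv_rhs => rw [← ha]
    simp [conjTranspose_sum, fun i => (hw i).isHermitian.eq]
  have upper : (aᴴ * a - ∑ i, (star (σ i a) * σ i a / σ i 1) • w i).PosSemidef := by
    conv in aᴴ * a - _ => rw [← haa]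
    rw [← Finset.sum_sub_distrib]
    refine posSemidef_sum _ fun i _ => ?_
    rw [← sub_smul]
    exact (hw i).smul (sub_nonneg.2 ((hσ i).star_mul_self_div_le a))
  have lower : ((∑ i, (star (σ i a) * σ i a / σ i 1) • w i) - a * aᴴ).PosSemidef := by
    have h : (∑ i, (σ i 1)⁻¹ • ((σ i a • (1 : Matrix d d ℂ) - σ i 1 • a) * w i *
        (σ i a • (1 : Matrix d d ℂ) - σ i 1 • a)ᴴ)).PosSemidef :=
      posSemidef_sum _ fun i _ => ((hw i).mul_mul_conjTranspose_same _).smul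
        (inv_nonneg.2 (hσ i _ PosSemidef.one))
    convert h using 1
    have hterm (i) : (σ i 1)⁻¹ • ((σ i a • (1 : Matrix d d ℂ) - σ i 1 • a) * w i *
        (σ i a • (1 : Matrix d d ℂ) - σ i 1 • a)ᴴ) =
        (star (σ i a) * σ i a / σ i 1) • w i - (σ i a • w i) * aᴴ - a * (star (σ i a) • w i)
          + a * (σ i 1 • w i) * aᴴ := by
      by_cases hi : σ i 1 = 0
      · simp [hi, (hσ i).apply_eq_zero hi]
      simp only [conjTranspose_sub, conjTranspose_smul, conjTranspose_one, sub_mul, mul_sub,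
        smul_mul_assoc, mul_smul_comm, one_mul, mul_one, smul_smul, smul_sub, hs]
      rw [show (σ i 1)⁻¹ * (σ i 1 * σ i 1) = σ i 1 by field_simp,
        show (σ i 1)⁻¹ * (σ i 1 * σ i a) = σ i a by field_simp,
        show (σ i 1)⁻¹ * (star (σ i a) * σ i 1) = star (σ i a) by field_simp,
        show (σ i 1)⁻¹ * (star (σ i a) * σ i a) = star (σ i a) * σ i a / σ i 1 by field_simp]
      abel
    simp only [hterm, Finset.sum_add_distrib, Finset.sum_sub_distrib, ← Finset.sum_mul,
      ← Finset.mul_sum, ha, ha', h1]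
    simp
  simpa using upper.add lower

/-- A star subalgebra of a complex star algebra all of whose elements are normal is commutative. -/
theorem StarSubalgebra.mul_comm_of_normal {R : Type*} [Ring R] [StarRing R] [Algebra ℂ R]
    [StarModule ℂ R] (A : StarSubalgebra ℂ R) (h : ∀ a ∈ A, star a * a = a * star a) :
    ∀ a ∈ A, ∀ b ∈ A, a * b = b * a := by
  have h1 (a) (ha : a ∈ A) (b) (hb : b ∈ A) :
      star a * b + star b * a = a * star b + b * star a := by
    have e := h _ (add_mem ha hb)
    simp only [star_add, add_mul, mul_add, h a ha, h b hb] at e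
    have : a * star a + b * star b + (star a * b + star b * a)
        = a * star a + b * star b + (a * star b + b * star a) := by
      convert e using 1 <;> abel
    exact add_left_cancel this
  have h2 (a) (ha : a ∈ A) (b) (hb : b ∈ A) : star a * b = b * star a := by
    have e1 := h1 a ha b hb
    have e2 := h1 a ha (Complex.I • b) (A.smul_mem hb Complex.I)
    simp only [star_smul, Complex.star_def, Complex.conj_I, mul_smul_comm, smul_mul_assoc,
      neg_smul, neg_mul, mul_neg] at e2
    rw [← sub_eq_add_neg, ← smul_sub, neg_add_eq_sub, ← smul_sub] at e2
    have e3 := (smul_right_injective R Complex.I_ne_zero) e2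
    have e4 : (2 : ℂ) • (star a * b) = (2 : ℂ) • (b * star a) := by
      rw [two_smul, two_smul]
      calc _ = (star a * b + star b * a) + (star a * b - star b * a) := by abel
        _ = (a * star b + b * star a) + (b * star a - a * star b) := by rw [e1, e3]
        _ = _ := by abel
    exact smul_right_injective R (two_ne_zero' ℂ) e4
  intro a ha b hb
  simpa using h2 (star a) (star_mem ha) b hb

/-- A commutative star algebra of matrices is diagonalized by a unitary. -/
theorem StarSubalgebra.exists_unitary_diagonalizing {n : ℕ}
    (A : StarSubalgebra ℂ (Matrix (Fin n) (Fin n) ℂ)) (hA : ∀ a ∈ A, ∀ b ∈ A, a * b = b * a) :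
    ∃ U : Matrix (Fin n) (Fin n) ℂ, Uᴴ * U = 1 ∧ ∀ a ∈ A, ∃ c, a * U = U * diagonal c := by
  classical
  let T (a : {a // a ∈ A ∧ a.IsHermitian}) : Module.End ℂ (EuclideanSpace ℂ (Fin n)) :=
    toEuclideanLin a.1
  have hT (a) : (T a).IsSymmetric := isSymmetric_toEuclideanLin_iff.2 a.2.2
  have hC : Pairwise (Function.onFun Commute T) := by
    intro a b _
    refine LinearMap.ext fun x => ?_
    simp [T, toLpLin_apply, hA _ a.2.1 _ b.2.1]
  let V (α : {a // a ∈ A ∧ a.IsHermitian} → ℂ) : Submodule ℂ (EuclideanSpace ℂ (Fin n)) :=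
    ⨅ j, Module.End.eigenspace (T j) (α j)
  have hint : DirectSum.IsInternal V :=
    LinearMap.IsSymmetric.directSum_isInternal_of_pairwise_commute hT hC
  have horth : OrthogonalFamily ℂ (fun α => V α) fun α => (V α).subtypeₗᵢ :=
    LinearMap.IsSymmetric.orthogonalFamily_iInf_eigenspaces hT
  have hfin := WellFoundedGT.finite_ne_bot_of_iSupIndep hint.submodule_iSupIndep
  have hint' := DirectSum.isInternal_ne_bot_iff.2 hint
  have horth' := horth.comp (γ := {α // V α ≠ ⊥}) Subtype.val_injective
  have : Fintype {α // V α ≠ ⊥} := hfin.fintype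
  have hn : Module.finrank ℂ (EuclideanSpace ℂ (Fin n)) = n := finrank_euclideanSpace_fin
  let u := hint'.subordinateOrthonormalBasis hn horth'
  have hu (a) (ha : a ∈ A) (hh : a.IsHermitian) (j : Fin n) :
      ∃ c : ℂ, a *ᵥ (u j).ofLp = c • (u j).ofLp := by
    have h := hint'.subordinateOrthonormalBasis_subordinate hn j horth'
    rw [Submodule.mem_iInf] at h
    have h' := Module.End.mem_eigenspace_iff.1 (h ⟨a, ha, hh⟩)
    exact ⟨_, congrArg WithLp.ofLp h'⟩
  have hu' (a) (ha : a ∈ A) (j : Fin n) : ∃ c : ℂ, a *ᵥ (u j).ofLp = c • (u j).ofLp := by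
    have hre : (realPart a : Matrix (Fin n) (Fin n) ℂ) ∈ A := by
      rw [realPart_apply_coe, ← Complex.coe_smul]
      exact A.smul_mem (add_mem ha (star_mem ha)) _
    have him : (imaginaryPart a : Matrix (Fin n) (Fin n) ℂ) ∈ A := by
      rw [imaginaryPart_apply_coe, ← Complex.coe_smul]
      exact A.smul_mem (A.smul_mem (sub_mem ha (star_mem ha)) _) _
    obtain ⟨c, hc⟩ := hu _ hre (realPart a).2 j
    obtain ⟨d, hd⟩ := hu _ him (imaginaryPart a).2 j
    refine ⟨c + Complex.I * d, ?_⟩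
    conv_lhs => rw [← realPart_add_I_smul_imaginaryPart a]
    rw [add_mulVec, smul_mulVec, hc, hd, add_smul, mul_smul]
  refine ⟨of fun i j => u j i, ?_, fun a ha => ?_⟩
  · ext i j
    have h := orthonormal_iff_ite.1 u.orthonormal i j
    rw [mul_apply, one_apply, ← h]
    simp [PiLp.inner_apply, mul_comm]
  · choose c hc using hu' a ha
    refine ⟨c, ?_⟩
    ext i j
    have h := congrFun (hc j) i
    rw [mul_diagonal, mul_apply]
    simpa [mulVec, dotProduct, mul_comm] using h

/-- Let `φ : M_n(ℂ) → M_n(ℂ)` be a conditional expectation onto a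
unital *-subalgebra `A`. Then the functional `φ̃(a ⊗ b) = Tr(φ(a) bᵀ)` is a separable
positive linear functional if and only if `A` is commutative. -/
theorem conditional_expectation_separable_iff_commutative (n : ℕ)
    (A : StarSubalgebra ℂ (Matrix (Fin n) (Fin n) ℂ))
    (φ : Matrix (Fin n) (Fin n) ℂ →ₗ[ℂ] Matrix (Fin n) (Fin n) ℂ)
    (hpos : ∀ x : Matrix (Fin n) (Fin n) ℂ, x.PosSemidef → (φ x).PosSemidef)
    (hrange : ∀ x : Matrix (Fin n) (Fin n) ℂ, φ x ∈ A)
    (hfix : ∀ a ∈ A, φ a = a)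
    (hbimod : ∀ a ∈ A, ∀ b ∈ A, ∀ x : Matrix (Fin n) (Fin n) ℂ,
      φ (a * x * b) = a * φ x * b)
    (ρ : Matrix (Fin n × Fin n) (Fin n × Fin n) ℂ →ₗ[ℂ] ℂ)
    (hρ : ∀ (a b : Matrix (Fin n) (Fin n) ℂ), ρ (a ⊗ₖ b) = (φ a * bᵀ).trace) :
    IsSepFun n n ρ ↔ ∀ a ∈ A, ∀ b ∈ A, a * b = b * a := by
  constructor
  · rintro ⟨k, σ, ω, hσ, hω, hsep⟩
    set w : Fin k → Matrix (Fin n) (Fin n) ℂ := fun i => of fun p q => ω i (single p q 1) with hw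
    have hdec (x : Matrix (Fin n) (Fin n) ℂ) : ∑ i, σ i x • w i = φ x := by
      ext p q
      have h := hsep x (single p q 1)
      rw [hρ, transpose_single, trace_mul_single] at h
      simpa [hw, Matrix.sum_apply, Matrix.smul_apply] using h.symm
    have hle (a) (ha : a ∈ A) : (aᴴ * a - a * aᴴ).PosSemidef := by
      refine posSemidef_conjTranspose_mul_self_sub hσ (fun i => (hω i).posSemidef_of_single)
        ?_ ?_ ?_
      · rw [hdec, hfix _ (one_mem A)]
      · rw [hdec, hfix _ ha]
      · rw [hdec, hfix (aᴴ * a) (mul_mem (star_mem ha) ha)]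
    refine A.mul_comm_of_normal fun a ha => ?_
    have h := (hle a ha).trace_eq_zero_iff.1 (by rw [trace_sub, trace_mul_comm, sub_self])
    exact sub_eq_zero.1 h
  · intro hA
    obtain ⟨U, hU, hdiag⟩ := A.exists_unitary_diagonalizing hA
    let D (j : Fin n) : Matrix (Fin n) (Fin n) ℂ →ₗ[ℂ] ℂ :=
      entryLinearMap ℂ ℂ j j ∘ₗ LinearMap.mulRight ℂ U ∘ₗ LinearMap.mulLeft ℂ Uᴴ
    have hD (j x) : D j x = (Uᴴ * x * U) j j := rfl
    have hDpos (j) : IsPosFun (D j) := fun x hx =>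
      (hx.conjTranspose_mul_mul_same U).diag_nonneg
    refine ⟨n, fun j => D j ∘ₗ φ, fun j => D j ∘ₗ (transposeLinearEquiv _ _ ℂ ℂ).toLinearMap,
      fun j x hx => hDpos j _ (hpos x hx), fun j x hx => hDpos j _ hx.transpose,
      fun a b => ?_⟩
    obtain ⟨c, hc⟩ := hdiag _ (hrange a)
    have hU' : U * Uᴴ = 1 := mul_eq_one_comm.1 hU
    have hφ : φ a = U * diagonal c * Uᴴ := by rw [← hc, mul_assoc, hU', mul_one]
    have hcj (j) : D j (φ a) = c j := by
      rw [hD, mul_assoc, hc, ← mul_assoc, hU, one_mul, diagonal_apply_eq]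
    rw [hρ, hφ, mul_assoc, mul_assoc, trace_mul_comm, mul_assoc]
    simp [hcj, hD, trace, diagonal_mul, mul_assoc]
end
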